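/- arXiv:0810.0777 — 2 statements merged into one kernel-verified Lean document; each statement's English description precedes it below -/
import Mathlib

section
/- Let α be a real number and 0 < δ < 1 be such that q·‖αq‖ ≥ δ for every positive integer q. Then there exists a real number β such that liminf_{q→∞} (q·(log₂ q)²)·‖αq‖·‖βq‖ > 0, where the liminf is taken over positive integers q. -/
/-- Distance from a real number to the nearest integer. -/
noncomputable def nint (t : ℝ) : ℝ := |t - round t|

/-! ### Distance to the nearest integer -/

lemma nint_nonneg (t : ℝ) : 0 ≤ nint t := abs_nonneg _

lemma nint_le_abs_sub (t : ℝ) (z : ℤ) : nint t ≤ |t - z| := round_le t z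

lemma nint_le_add_abs_sub (x y : ℝ) : nint y ≤ nint x + |x - y| := by
  have h₁ := nint_le_abs_sub y (round x)
  have h₂ : |y - round x| ≤ |y - x| + |x - round x| := abs_sub_le _ _ _
  rw [abs_sub_comm y x] at h₂
  unfold nint at *
  linarith

lemma continuous_nint : Continuous nint := by
  refine (LipschitzWith.of_le_add_mul 1 fun x y => ?_).continuous
  rw [Real.dist_eq, NNReal.coe_one, one_mul, abs_sub_comm]
  exact nint_le_add_abs_sub y x

lemma nint_eq_of_abs_sub_lt {t : ℝ} {z : ℤ} (h : |t - z| < 1 / 2) :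
    round t = z ∧ nint t = |t - z| := by
  have hr : round t = z := by
    rw [abs_lt] at h
    rw [round_eq, Int.floor_eq_iff]
    constructor <;> linarith
  exact ⟨hr, by rw [nint, hr]⟩

/-- The points `x` for which `x * q` is within `r` of an integer. -/
def nearSet (q : ℕ) (r : ℝ) : Set ℝ := {x | nint (x * q) ≤ r}

lemma isClosed_nearSet (q : ℕ) (r : ℝ) : IsClosed (nearSet q r) :=
  isClosed_le (continuous_nint.comp (continuous_id.mul continuous_const)) continuous_const

lemma measurableSet_nearSet (q : ℕ) (r : ℝ) : MeasurableSet (nearSet q r) :=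
  (isClosed_nearSet q r).measurableSet

/-- `α` is badly approximable with constant `δ`. -/
def BadlyApprox (α δ : ℝ) : Prop := ∀ q : ℕ, 0 < q → δ ≤ (q : ℝ) * nint (α * q)

lemma BadlyApprox.le_abs_mul {α δ : ℝ} (h : BadlyApprox α δ) {w : ℤ} (hw : w ≠ 0) (z : ℤ) :
    δ ≤ |(w : ℝ)| * |α * w - z| := by
  have h₁ := h w.natAbs (Int.natAbs_pos.mpr hw)
  have h₂ : ((w.natAbs : ℕ) : ℝ) = |(w : ℝ)| := by rw [Nat.cast_natAbs, Int.cast_abs]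
  rw [h₂] at h₁
  refine h₁.trans (mul_le_mul_of_nonneg_left ?_ (abs_nonneg _))
  rcases abs_choice (w : ℝ) with h₃ | h₃ <;> rw [h₃]
  · exact nint_le_abs_sub _ _
  · have h₄ := nint_le_abs_sub (α * -(w : ℝ)) (-z)
    rw [Int.cast_neg] at h₄
    rwa [← abs_neg (α * w - z), show -(α * w - z) = α * -(w : ℝ) - -(z : ℝ) by ring]

lemma BadlyApprox.nint_pos {α δ : ℝ} (h : BadlyApprox α δ) (hδ : 0 < δ) {q : ℕ} (hq : 0 < q) :
    0 < nint (α * q) := by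
  have := h q hq
  by_contra hn
  have h0 : nint (α * q) = 0 := le_antisymm (not_lt.mp hn) (nint_nonneg _)
  rw [h0] at this
  linarith

lemma BadlyApprox.mul_nint_pos {α δ : ℝ} (h : BadlyApprox α δ) (hδ : 0 < δ) {q : ℕ}
    (hq : 0 < q) : 0 < (q : ℝ) * nint (α * q) := hδ.trans_le (h q hq)

/-! ### Upper bound for the sum of `1 / (q * nint (α * q))` -/

lemma sum_one_div_le_of_separated {s : Finset ℕ} {f : ℕ → ℝ} {d : ℝ} {M : ℕ} (hd : 0 < d)
    (hlow : ∀ q ∈ s, d ≤ f q) (hupp : ∀ q ∈ s, f q < d * M)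
    (hsep : ∀ q ∈ s, ∀ q' ∈ s, q ≠ q' → d ≤ |f q - f q'|) :
    ∑ q ∈ s, 1 / f q ≤ 2 / d * (1 + Real.log M) := by
  have hk : ∀ q ∈ s, (1 : ℝ) ≤ ⌊f q / d⌋₊ := fun q hq => by
    exact_mod_cast Nat.le_floor (by rw [Nat.cast_one, le_div_iff₀ hd]; linarith [hlow q hq])
  have hfl : ∀ q ∈ s, (⌊f q / d⌋₊ : ℝ) * d ≤ f q := fun q hq => by
    rw [← le_div_iff₀ hd]
    exact Nat.floor_le (div_nonneg (hd.le.trans (hlow q hq)) hd.le)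
  have hfu : ∀ q ∈ s, f q < ((⌊f q / d⌋₊ : ℝ) + 1) * d := fun q _ => by
    rw [← div_lt_iff₀ hd]
    exact Nat.lt_floor_add_one _
  have hinj : Set.InjOn (fun q => ⌊f q / d⌋₊) s := by
    intro q hq q' hq' h
    by_contra hne
    have h₁ := hsep q hq q' hq' hne
    have h₂ := hfl q hq
    have h₃ := hfl q' hq'
    have h₄ := hfu q hq
    have h₅ := hfu q' hq'
    simp only at h
    rw [h] at h₂ h₄
    have : |f q - f q'| < d := by rw [abs_lt]; constructor <;> linarith
    linarith
  have himg : s.image (fun q => ⌊f q / d⌋₊) ⊆ Finset.Icc 1 M := by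
    intro k hkm
    obtain ⟨q, hq, rfl⟩ := Finset.mem_image.mp hkm
    rw [Finset.mem_Icc]
    refine ⟨by exact_mod_cast hk q hq, ?_⟩
    have : (⌊f q / d⌋₊ : ℝ) < M := by
      have := hfl q hq
      have := hupp q hq
      by_contra hcon
      nlinarith [mul_le_mul_of_nonneg_right (not_lt.mp hcon) hd.le]
    exact_mod_cast this.le
  have hharm : ∑ k ∈ Finset.Icc 1 M, (1 : ℝ) / k ≤ 1 + Real.log M := by
    have := harmonic_le_one_add_log M
    rw [harmonic_eq_sum_Icc] at this
    push_cast at this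
    simpa [one_div] using this
  calc ∑ q ∈ s, 1 / f q ≤ ∑ q ∈ s, 1 / d * (1 / (⌊f q / d⌋₊ : ℝ)) := by
        refine Finset.sum_le_sum fun q hq => ?_
        have h₁ := hk q hq
        rw [one_div_mul_one_div]
        exact one_div_le_one_div_of_le (by positivity) (by linarith [hfl q hq])
    _ = 1 / d * ∑ k ∈ s.image (fun q => ⌊f q / d⌋₊), (1 : ℝ) / k := by
        rw [Finset.sum_image hinj, Finset.mul_sum]
    _ ≤ 1 / d * ∑ k ∈ Finset.Icc 1 M, (1 : ℝ) / k := by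
        gcongr
    _ ≤ 2 / d * (1 + Real.log M) := by
        have h0 : 0 ≤ ∑ k ∈ Finset.Icc 1 M, (1 : ℝ) / k := by positivity
        have : 1 / d ≤ 2 / d := by gcongr; norm_num
        exact mul_le_mul this hharm h0 (by positivity)

lemma BadlyApprox.sum_block_le {α δ : ℝ} (h : BadlyApprox α δ) (hδ : 0 < δ) {Q M : ℕ}
    (hQ : 0 < Q) (hM : (Q : ℝ) / δ < M) :
    ∑ q ∈ Finset.Ico Q (2 * Q), 1 / nint (α * q) ≤ 8 * Q / δ * (1 + Real.log M) := by
  have hQ' : (0 : ℝ) < Q := by exact_mod_cast hQ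
  have hd : 0 < δ / (2 * Q) := by positivity
  have hlow : ∀ q ∈ Finset.Ico Q (2 * Q), δ / (2 * Q) ≤ nint (α * q) := fun q hq => by
    rw [Finset.mem_Ico] at hq
    have h₁ := h q (by omega)
    have h₂ : (q : ℝ) ≤ 2 * Q := by exact_mod_cast hq.2.le
    rw [div_le_iff₀ (by positivity)]
    nlinarith [nint_nonneg (α * q)]
  have hupp : ∀ q ∈ Finset.Ico Q (2 * Q), nint (α * q) < δ / (2 * Q) * M := fun q _ => by
    have h₁ : nint (α * q) ≤ 1 / 2 := abs_sub_round _
    have h₂ : (1 : ℝ) / 2 = δ / (2 * Q) * (Q / δ) := by field_simp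
    have h₃ := mul_lt_mul_of_pos_left hM hd
    linarith
  have hsep : ∀ q ∈ Finset.Ico Q (2 * Q), ∀ q' ∈ Finset.Ico Q (2 * Q), q ≠ q' →
      δ / (2 * Q) ≤ |(α * q - round (α * q)) - (α * q' - round (α * q'))| := by
    intro q hq q' hq' hne
    rw [Finset.mem_Ico] at hq hq'
    have h₁ := h.le_abs_mul (w := (q : ℤ) - q') (by omega) (round (α * q) - round (α * q'))
    push_cast at h₁
    have h₂ : |(q : ℝ) - q'| ≤ 2 * Q := by
      have a₁ : (q : ℝ) ≤ 2 * Q := by exact_mod_cast hq.2.le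
      have a₂ : (q' : ℝ) ≤ 2 * Q := by exact_mod_cast hq'.2.le
      rw [abs_le]; constructor <;> linarith [(Nat.cast_nonneg q : (0 : ℝ) ≤ q),
        (Nat.cast_nonneg q' : (0 : ℝ) ≤ q')]
    rw [div_le_iff₀ (by positivity), mul_comm]
    refine h₁.trans ?_
    rw [show α * q - round (α * q) - (α * q' - round (α * q'))
      = α * ((q : ℝ) - q') - ((round (α * q) : ℝ) - round (α * q')) by ring]
    gcongr
  have hval : 2 / (δ / (2 * Q)) * (1 + Real.log M) = 4 * Q / δ * (1 + Real.log M) := by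
    field_simp; norm_num
  rw [← Finset.sum_filter_add_sum_filter_not _ (fun q : ℕ => 0 ≤ α * q - round (α * q))]
  have hpos : ∑ q ∈ (Finset.Ico Q (2 * Q)).filter (fun q : ℕ => 0 ≤ α * q - round (α * q)),
      1 / nint (α * q)
      ≤ 4 * Q / δ * (1 + Real.log M) := by
    rw [← hval]
    refine sum_one_div_le_of_separated hd (fun q hq => hlow q (Finset.mem_filter.mp hq).1)
      (fun q hq => hupp q (Finset.mem_filter.mp hq).1) fun q hq q' hq' hne => ?_
    rw [Finset.mem_filter] at hq hq'
    have := hsep q hq.1 q' hq'.1 hne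
    rwa [nint, nint, abs_of_nonneg hq.2, abs_of_nonneg hq'.2]
  have hneg : ∑ q ∈ (Finset.Ico Q (2 * Q)).filter (fun q : ℕ => ¬ 0 ≤ α * q - round (α * q)),
      1 / nint (α * q)
      ≤ 4 * Q / δ * (1 + Real.log M) := by
    rw [← hval]
    refine sum_one_div_le_of_separated hd (fun q hq => hlow q (Finset.mem_filter.mp hq).1)
      (fun q hq => hupp q (Finset.mem_filter.mp hq).1) fun q hq q' hq' hne => ?_
    rw [Finset.mem_filter, not_le] at hq hq'
    have := hsep q hq.1 q' hq'.1 hne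
    rwa [nint, nint, abs_of_neg hq.2, abs_of_neg hq'.2, ← abs_neg,
      show ∀ a b : ℝ, -(-a - -b) = a - b by intros; ring]
  calc _ ≤ 4 * Q / δ * (1 + Real.log M) + 4 * Q / δ * (1 + Real.log M) := add_le_add hpos hneg
    _ = _ := by ring

lemma BadlyApprox.exists_sum_le {α δ : ℝ} (h : BadlyApprox α δ) (hδ : 0 < δ) :
    ∃ C : ℝ, 0 < C ∧ ∀ T : ℕ,
      ∑ q ∈ Finset.Ico (1 : ℕ) (2 ^ T), 1 / ((q : ℝ) * nint (α * q)) ≤ C * (T : ℝ) ^ 2 := by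
  obtain ⟨k, hk⟩ := pow_unbounded_of_one_lt (1 / δ) (one_lt_two : (1 : ℝ) < 2)
  have hblock : ∀ j : ℕ, ∑ q ∈ Finset.Ico (2 ^ j : ℕ) (2 ^ (j + 1)), 1 / ((q : ℝ) * nint (α * q))
      ≤ 8 / δ * (1 + (j + k)) := by
    intro j
    have hM : ((2 ^ j : ℕ) : ℝ) / δ < (2 ^ (j + k) : ℕ) := by
      push_cast
      rw [pow_add, div_eq_mul_one_div]
      exact mul_lt_mul_of_pos_left hk (by positivity)
    have hb := h.sum_block_le hδ (Q := 2 ^ j) (by positivity) hM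
    rw [pow_succ, mul_comm (2 ^ j) 2]
    have hlog : Real.log ((2 ^ (j + k) : ℕ) : ℝ) ≤ j + k := by
      push_cast
      rw [Real.log_pow]
      push_cast
      have := Real.log_two_lt_d9
      have h0 : (0 : ℝ) ≤ j + k := by positivity
      nlinarith
    calc _ ≤ ∑ q ∈ Finset.Ico (2 ^ j : ℕ) (2 * 2 ^ j), 1 / (2 ^ j : ℝ) * (1 / nint (α * q)) := by
          refine Finset.sum_le_sum fun q hq => ?_
          rw [Finset.mem_Ico] at hq
          have hq0 : 0 < q := lt_of_lt_of_le (by positivity) hq.1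
          have := h.nint_pos hδ hq0
          have hq1 : (2 ^ j : ℝ) ≤ q := by exact_mod_cast hq.1
          rw [one_div_mul_one_div]
          exact one_div_le_one_div_of_le (by positivity) (by gcongr)
      _ ≤ 1 / (2 ^ j : ℝ) * (8 * (2 ^ j : ℕ) / δ * (1 + Real.log ((2 ^ (j + k) : ℕ) : ℝ))) := by
          rw [← Finset.mul_sum]
          gcongr
      _ = 8 / δ * (1 + Real.log ((2 ^ (j + k) : ℕ) : ℝ)) := by
          push_cast
          field_simp
      _ ≤ _ := by gcongr
  refine ⟨8 / δ * (k + 1), by positivity, fun T => ?_⟩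
  induction T with
  | zero => simp
  | succ j ih =>
    rw [← Finset.sum_Ico_consecutive _ (Nat.one_le_two_pow : 1 ≤ 2 ^ j)
      (Nat.pow_le_pow_right (by norm_num) (Nat.le_succ j))]
    have hstep : 8 / δ * (1 + ((j : ℝ) + k)) ≤ 8 / δ * (k + 1) * (2 * j + 1) := by
      rw [mul_assoc]
      have hj : (0 : ℝ) ≤ j := by positivity
      have hk0 : (0 : ℝ) ≤ k := by positivity
      gcongr
      nlinarith [mul_nonneg hj hk0]
    have := hblock j
    push_cast
    calc _ ≤ 8 / δ * (k + 1) * (j : ℝ) ^ 2 + 8 / δ * (1 + ((j : ℝ) + k)) := add_le_add ih this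
      _ ≤ 8 / δ * (k + 1) * (j : ℝ) ^ 2 + 8 / δ * (k + 1) * (2 * j + 1) := by linarith
      _ = _ := by ring

/-! ### Totients -/

lemma sum_one_div_le_two_mul_sum_totient (N : ℕ) :
    ∑ n ∈ Finset.Icc 1 N, (1 : ℝ) / n ≤
      2 * ∑ n ∈ Finset.Icc 1 N, (Nat.totient n : ℝ) / (n : ℝ) ^ 2 := by
  have hsq : ∀ M : ℕ, ∑ k ∈ Finset.Icc 1 M, (1 : ℝ) / (k : ℝ) ^ 2 ≤ 2 := by
    intro M
    have h : ∀ M : ℕ, ∑ k ∈ Finset.Icc 1 (M + 1), (1 : ℝ) / (k : ℝ) ^ 2 ≤ 2 - 1 / (M + 1) := by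
      intro M
      induction M with
      | zero => norm_num
      | succ M ih =>
        rw [Finset.sum_Icc_succ_top (by omega)]
        have : (1 : ℝ) / ((M + 1 + 1 : ℕ) : ℝ) ^ 2 ≤ 1 / (M + 1) - 1 / ((M + 1 : ℕ) + 1) := by
          push_cast
          rw [div_sub_div _ _ (by positivity) (by positivity),
            div_le_div_iff₀ (by positivity) (by positivity)]
          nlinarith [(Nat.cast_nonneg M : (0 : ℝ) ≤ M)]
        linarith
    cases M with
    | zero => simp
    | succ M =>
      have h1 := h M
      have h2 : (0 : ℝ) ≤ 1 / (M + 1) := by positivity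
      linarith
  calc ∑ n ∈ Finset.Icc 1 N, (1 : ℝ) / n
      = ∑ n ∈ Finset.Icc 1 N, ∑ d ∈ n.divisors, (Nat.totient d : ℝ) / (n : ℝ) ^ 2 := by
        refine Finset.sum_congr rfl fun n hn => ?_
        have hn0 : (n : ℝ) ≠ 0 := by
          have := (Finset.mem_Icc.mp hn).1
          positivity
        rw [← Finset.sum_div]
        have : (∑ d ∈ n.divisors, (Nat.totient d : ℝ)) = n := by
          exact_mod_cast Nat.sum_totient n
        rw [this]
        field_simp
    _ = ∑ d ∈ Finset.Icc 1 N, ∑ k ∈ Finset.Icc 1 (N / d),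
          (Nat.totient d : ℝ) / ((d * k : ℕ) : ℝ) ^ 2 := by
        rw [Finset.sum_sigma', Finset.sum_sigma']
        refine Finset.sum_bij' (fun x _ => ⟨x.2, x.1 / x.2⟩) (fun x _ => ⟨x.1 * x.2, x.1⟩)
          ?_ ?_ ?_ ?_ ?_
        · rintro ⟨n, d⟩ hx
          simp only [Finset.mem_sigma, Finset.mem_Icc, Nat.mem_divisors] at hx ⊢
          obtain ⟨⟨h1, h2⟩, h3, h4⟩ := hx
          have hd := Nat.pos_of_dvd_of_pos h3 h1
          have hdn := Nat.le_of_dvd h1 h3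
          exact ⟨⟨hd, hdn.trans h2⟩, Nat.div_pos hdn hd, Nat.div_le_div_right h2⟩
        · rintro ⟨d, k⟩ hx
          simp only [Finset.mem_sigma, Finset.mem_Icc, Nat.mem_divisors] at hx ⊢
          obtain ⟨⟨h1, h2⟩, h3, h4⟩ := hx
          have : 0 < d * k := Nat.mul_pos h1 h3
          refine ⟨⟨this, ?_⟩, dvd_mul_right _ _, this.ne'⟩
          calc d * k ≤ d * (N / d) := Nat.mul_le_mul_left _ h4
            _ ≤ N := Nat.mul_div_le _ _
        · rintro ⟨n, d⟩ hx
          simp only [Finset.mem_sigma, Finset.mem_Icc, Nat.mem_divisors] at hx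
          simp [Nat.mul_div_cancel' hx.2.1]
        · rintro ⟨d, k⟩ hx
          simp only [Finset.mem_sigma, Finset.mem_Icc] at hx
          simp [Nat.mul_div_cancel_left k hx.1.1]
        · rintro ⟨n, d⟩ hx
          simp only [Finset.mem_sigma, Finset.mem_Icc, Nat.mem_divisors] at hx
          simp only [Nat.mul_div_cancel' hx.2.1]
    _ = ∑ d ∈ Finset.Icc 1 N, (Nat.totient d : ℝ) / (d : ℝ) ^ 2 *
          ∑ k ∈ Finset.Icc 1 (N / d), (1 : ℝ) / (k : ℝ) ^ 2 := by
        refine Finset.sum_congr rfl fun d _ => ?_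
        rw [Finset.mul_sum]
        refine Finset.sum_congr rfl fun k _ => ?_
        push_cast
        rw [mul_pow, div_mul_div_comm, mul_one]
    _ ≤ ∑ d ∈ Finset.Icc 1 N, (Nat.totient d : ℝ) / (d : ℝ) ^ 2 * 2 := by
        gcongr with d _
        exact hsq _
    _ = _ := by rw [← Finset.sum_mul, mul_comm]

/-! ### Bases of `ℤ²` adapted to the line of slope `α` -/

/-- A positively oriented basis `(p₀, a₀), (p₁, a₁)` of `ℤ²` whose two elements lie on either side
of the line of slope `α`. -/
structure ApproxPair (α : ℝ) where
  (p₀ a₀ p₁ a₁ : ℤ)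
  p₀_nonneg : 0 ≤ p₀
  p₀_le : p₀ ≤ p₁
  p₁_pos : 0 < p₁
  neg_side : α * p₁ - a₁ < 0
  neg_lt : -(α * p₁ - a₁) < α * p₀ - a₀
  det : p₀ * a₁ - p₁ * a₀ = 1

lemma exists_last_positive {x y K : ℝ} (hy : 0 < y) (hyx : y < x) (hK : x ≤ K * y)
    (hne : ∀ t : ℤ, x - t * y ≠ 0) :
    ∃ t : ℤ, 1 ≤ t ∧ (t : ℝ) ≤ K ∧ 0 < x - t * y ∧ x - t * y < y := by
  have h₁ : (⌊x / y⌋ : ℝ) * y ≤ x := by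
    rw [← le_div_iff₀ hy]; exact Int.floor_le _
  have h₂ : x < (⌊x / y⌋ + 1) * y := by
    rw [← div_lt_iff₀ hy]; exact Int.lt_floor_add_one _
  refine ⟨⌊x / y⌋, ?_, ?_, ?_, by linarith⟩
  · rw [Int.le_floor, Int.cast_one, le_div_iff₀ hy]; linarith
  · exact (Int.floor_le _).trans ((div_le_iff₀ hy).mpr hK)
  · exact lt_of_le_of_ne (by linarith) (hne _).symm

lemma BadlyApprox.sub_ne_zero {α δ : ℝ} (h : BadlyApprox α δ) (hδ : 0 < δ) {p : ℤ} (hp : p ≠ 0)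
    (a : ℤ) : α * p - a ≠ 0 := fun h0 => by
  have := h.le_abs_mul hp a
  rw [h0, abs_zero, mul_zero] at this
  linarith

namespace ApproxPair

variable {α δ : ℝ} (P : ApproxPair α)

lemma det_real : (P.p₁ : ℝ) * (α * P.p₀ - P.a₀) - P.p₀ * (α * P.p₁ - P.a₁) = 1 := by
  have : (P.p₀ : ℝ) * P.a₁ - P.p₁ * P.a₀ = 1 := by exact_mod_cast P.det
  linarith

lemma pos_side : 0 < α * P.p₀ - P.a₀ := by linarith [P.neg_lt, P.neg_side]

lemma mul_pos_side_le : (P.p₁ : ℝ) * (α * P.p₀ - P.a₀) ≤ 1 := by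
  have h₁ : (0 : ℝ) ≤ P.p₀ := by exact_mod_cast P.p₀_nonneg
  nlinarith [P.det_real, P.neg_side]

/-- `P'` is obtained from `P` by two steps of the continued fraction algorithm. -/
def Step (K : ℕ) (P P' : ApproxPair α) : Prop :=
  1 ≤ P'.p₀ ∧ 2 * P.p₁ ≤ P'.p₁ ∧ P'.p₁ ≤ (K + 1) ^ 2 * P.p₁ ∧
    ∃ t : ℤ, 1 ≤ t ∧ P'.p₀ = P.p₀ + t * P.p₁ ∧ P'.a₀ = P.a₀ + t * P.a₁

lemma exists_step (h : BadlyApprox α δ) (hδ : 0 < δ) {K : ℕ} (hK : 1 / δ ≤ K) :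
    ∃ P', Step K P P' := by
  have hKδ : 1 ≤ K * δ := by rwa [div_le_iff₀ hδ] at hK
  have hK0 : (0 : ℝ) ≤ K := by positivity
  have hp₁ : (0 : ℝ) < P.p₁ := by exact_mod_cast P.p₁_pos
  have hp₀ : (0 : ℝ) ≤ P.p₀ := by exact_mod_cast P.p₀_nonneg
  have hneg := P.neg_side
  have hb₁ := h.le_abs_mul P.p₁_pos.ne' P.a₁
  rw [abs_of_pos hp₁, abs_of_neg hneg] at hb₁
  obtain ⟨t, ht1, htK, htpos, htlt⟩ := exists_last_positive (x := α * P.p₀ - P.a₀)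
    (y := -(α * P.p₁ - P.a₁)) (K := K) (by linarith) P.neg_lt (by
      have h₁ := P.mul_pos_side_le
      have h₂ : P.p₁ * (α * P.p₀ - P.a₀) ≤ P.p₁ * (K * -(α * P.p₁ - P.a₁)) := by nlinarith
      exact le_of_mul_le_mul_left h₂ hp₁) (by
      intro t ht
      have hcast : α * ((P.p₀ + t * P.p₁ : ℤ) : ℝ) - ((P.a₀ + t * P.a₁ : ℤ) : ℝ) = 0 := by
        push_cast; linarith
      by_cases h0 : P.p₀ + t * P.p₁ = 0
      · have hd := P.det
        have ha : P.a₀ + t * P.a₁ = 0 := by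
          rw [h0, Int.cast_zero, mul_zero, zero_sub, neg_eq_zero] at hcast
          exact_mod_cast hcast
        have : (0 : ℤ) = 1 := by
          rw [← hd]; linear_combination -P.a₁ * h0 + P.p₁ * ha
        omega
      · exact h.sub_ne_zero hδ h0 _ hcast)
  have ht1' : (1 : ℝ) ≤ t := by exact_mod_cast ht1
  set p₂ := P.p₀ + t * P.p₁ with hp₂
  set a₂ := P.a₀ + t * P.a₁ with ha₂
  have hη₂ : α * p₂ - a₂ = α * P.p₀ - P.a₀ - t * -(α * P.p₁ - P.a₁) := by
    rw [hp₂, ha₂]; push_cast; ring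
  rw [← hη₂] at htpos htlt
  have hp₁₂ : P.p₁ ≤ p₂ := by nlinarith [P.p₀_nonneg, P.p₁_pos]
  have hp₂pos : 0 < p₂ := P.p₁_pos.trans_le hp₁₂
  have hp₂' : (0 : ℝ) < p₂ := by exact_mod_cast hp₂pos
  have hdet : (p₂ : ℝ) * -(α * P.p₁ - P.a₁) + P.p₁ * (α * p₂ - a₂) = 1 := by
    rw [hη₂, hp₂]; push_cast; linarith [P.det_real]
  have hb₂ := h.le_abs_mul hp₂pos.ne' a₂
  rw [abs_of_pos hp₂', abs_of_pos htpos] at hb₂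
  obtain ⟨s, hs1, hsK, hspos, hslt⟩ := exists_last_positive (x := -(α * P.p₁ - P.a₁))
    (y := α * p₂ - a₂) (K := K) htpos htlt (by
      have h₁ : (p₂ : ℝ) * -(α * P.p₁ - P.a₁) ≤ 1 := by nlinarith
      have h₂ : p₂ * -(α * P.p₁ - P.a₁) ≤ p₂ * (K * (α * p₂ - a₂)) := by nlinarith
      exact le_of_mul_le_mul_left h₂ hp₂') (by
      intro s hs
      by_cases h0 : P.p₁ + s * p₂ = 0
      · have hcast : α * ((P.p₁ + s * p₂ : ℤ) : ℝ) - ((P.a₁ + s * a₂ : ℤ) : ℝ) = 0 := by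
          push_cast; linarith
        have ha : P.a₁ + s * a₂ = 0 := by
          rw [h0, Int.cast_zero, mul_zero, zero_sub, neg_eq_zero] at hcast
          exact_mod_cast hcast
        have hd : p₂ * P.a₁ - P.p₁ * a₂ = 1 := by
          rw [hp₂, ha₂]; linear_combination P.det
        have : (0 : ℤ) = 1 := by
          rw [← hd]; linear_combination a₂ * h0 - p₂ * ha
        omega
      · refine h.sub_ne_zero hδ h0 (P.a₁ + s * a₂) ?_
        push_cast; linarith)
  have hη₃ : α * (P.p₁ + s * p₂ : ℤ) - (P.a₁ + s * a₂ : ℤ)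
      = -(-(α * P.p₁ - P.a₁) - s * (α * p₂ - a₂)) := by
    push_cast; ring
  have htK' : t ≤ K := by exact_mod_cast htK
  have hsK' : s ≤ K := by exact_mod_cast hsK
  refine ⟨⟨p₂, a₂, P.p₁ + s * p₂, P.a₁ + s * a₂, hp₂pos.le, ?_, ?_, ?_, ?_, ?_⟩, ?_, ?_, ?_,
    t, ht1, rfl, rfl⟩
  · nlinarith [P.p₁_pos]
  · nlinarith [P.p₁_pos]
  · rw [hη₃]; linarith
  · rw [hη₃]; linarith
  · rw [hp₂, ha₂]; linear_combination P.det
  · exact hp₂pos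
  · change 2 * P.p₁ ≤ P.p₁ + s * p₂
    nlinarith [P.p₁_pos]
  · change P.p₁ + s * p₂ ≤ (K + 1) ^ 2 * P.p₁
    have h₁ : p₂ ≤ (K + 1) * P.p₁ := by
      rw [hp₂]; nlinarith [P.p₀_le, P.p₁_pos]
    have h₂ : P.p₁ + s * p₂ ≤ (K + 1) * p₂ := by nlinarith
    calc P.p₁ + s * p₂ ≤ (K + 1) * p₂ := h₂
      _ ≤ (K + 1) * ((K + 1) * P.p₁) := by gcongr
      _ = _ := by ring

lemma exists_init (h : BadlyApprox α δ) (hδ : 0 < δ) : ∃ P : ApproxPair α, P.p₁ = 1 := by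
  have h₁ := h.sub_ne_zero hδ one_ne_zero ⌈α⌉
  rw [Int.cast_one, mul_one] at h₁
  have h₂ := Int.le_ceil α
  have h₃ := Int.ceil_lt_add_one α
  refine ⟨⟨0, -1, 1, ⌈α⌉, le_rfl, by norm_num, by norm_num, ?_, ?_, by ring⟩, rfl⟩
  · rw [Int.cast_one, mul_one]
    exact lt_of_le_of_ne (by linarith) h₁
  · push_cast; linarith

lemma exists_seq (h : BadlyApprox α δ) (hδ : 0 < δ) :
    ∃ (P : ℕ → ApproxPair α) (L : ℕ), ∀ i, 1 ≤ (P i).p₀ ∧ 2 ^ i ≤ (P i).p₁ ∧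
      (P i).p₁ ≤ 2 ^ (L * (i + 1)) ∧
      ∃ t : ℤ, 1 ≤ t ∧ (P (i + 1)).p₀ = (P i).p₀ + t * (P i).p₁ ∧
        (P (i + 1)).a₀ = (P i).a₀ + t * (P i).a₁ := by
  obtain ⟨P₀, hP₀⟩ := exists_init h hδ
  choose f hf using fun P : ApproxPair α => P.exists_step h hδ (Nat.le_ceil (1 / δ))
  set K := ⌈1 / δ⌉₊
  obtain ⟨L, hL⟩ := pow_unbounded_of_one_lt ((K + 1 : ℤ) ^ 2) (one_lt_two : (1 : ℤ) < 2)
  have hlow : ∀ i, 2 ^ i ≤ (f^[i] P₀).p₁ := by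
    intro i
    induction i with
    | zero => simp [hP₀]
    | succ i ih =>
      rw [Function.iterate_succ_apply', pow_succ, mul_comm]
      exact (mul_le_mul_of_nonneg_left ih (by norm_num)).trans (hf _).2.1
  have hupp : ∀ i, (f^[i] P₀).p₁ ≤ 2 ^ (L * i) := by
    intro i
    induction i with
    | zero => simp [hP₀]
    | succ i ih =>
      rw [Function.iterate_succ_apply', mul_add, mul_one, pow_add, mul_comm]
      exact (hf _).2.2.1.trans (mul_le_mul hL.le ih (f^[i] P₀).p₁_pos.le (by positivity))
  refine ⟨fun i => f^[i + 1] P₀, L, fun i => ⟨?_, ?_, hupp _, ?_⟩⟩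
  · change 1 ≤ (f^[i + 1] P₀).p₀
    rw [Function.iterate_succ_apply']
    exact (hf _).1
  · exact (pow_le_pow_right₀ (by norm_num) (Nat.le_succ i)).trans (hlow _)
  · change ∃ t : ℤ, 1 ≤ t ∧ (f^[i + 1 + 1] P₀).p₀ = _ ∧ (f^[i + 1 + 1] P₀).a₀ = _
    rw [Function.iterate_succ_apply' f (i + 1)]
    exact (hf _).2.2.2

/-- First coordinate of the combination `(n + y) e₀ + y e₁` of the basis vectors. -/
def vecP (n y : ℕ) : ℤ := (n + y) * P.p₀ + y * P.p₁

/-- Second coordinate of the combination `(n + y) e₀ + y e₁` of the basis vectors. -/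
def vecA (n y : ℕ) : ℤ := (n + y) * P.a₀ + y * P.a₁

lemma vec_det_left (n y : ℕ) : P.vecA n y * P.p₀ - P.vecP n y * P.a₀ = y := by
  unfold vecA vecP; linear_combination (y : ℤ) * P.det

lemma vec_det_right (n y : ℕ) : P.vecP n y * P.a₁ - P.vecA n y * P.p₁ = n + y := by
  unfold vecA vecP; linear_combination (n + y : ℤ) * P.det

lemma vec_inj {n y n' y' : ℕ} (hp : P.vecP n y = P.vecP n' y') (ha : P.vecA n y = P.vecA n' y') :
    n = n' ∧ y = y' := by
  have h₁ := P.vec_det_left n y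
  have h₂ := P.vec_det_right n y
  rw [hp, ha] at h₁ h₂
  rw [P.vec_det_left] at h₁
  rw [P.vec_det_right] at h₂
  omega

lemma vec_isCoprime {n y : ℕ} (h : Nat.Coprime n y) : IsCoprime (P.vecP n y) (P.vecA n y) := by
  obtain ⟨u, v, huv⟩ := Nat.isCoprime_iff_coprime.mpr h
  refine ⟨u * (P.a₁ + P.a₀) - v * P.a₀, v * P.p₀ - u * (P.p₁ + P.p₀), ?_⟩
  have h₁ := P.vec_det_left n y
  have h₂ := P.vec_det_right n y
  linear_combination huv + (v - u) * h₁ + u * h₂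

lemma vecP_pos {n y : ℕ} (hn : 1 ≤ n) (hp : 1 ≤ P.p₀) : 0 < P.vecP n y := by
  have h₁ : (1 : ℤ) ≤ n := by exact_mod_cast hn
  have h₂ := P.p₁_pos
  unfold vecP
  positivity

lemma vecP_le {n y : ℕ} (hy : y < n) : P.vecP n y ≤ 3 * n * P.p₁ := by
  have h₁ : (y : ℤ) ≤ n := by exact_mod_cast hy.le
  have h₂ := P.p₁_pos
  have h₃ := P.p₀_le
  have h₄ := P.p₀_nonneg
  unfold vecP
  calc ((n : ℤ) + y) * P.p₀ + y * P.p₁ ≤ (n + n) * P.p₁ + n * P.p₁ := by gcongr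
    _ = _ := by ring

lemma vec_side_pos {n y : ℕ} (hn : 1 ≤ n) : 0 < α * P.vecP n y - P.vecA n y := by
  have h₁ : (1 : ℝ) ≤ n := by exact_mod_cast hn
  have h₂ := P.pos_side
  have h₃ := P.neg_lt
  have hy : (0 : ℝ) ≤ y := by positivity
  have : α * P.vecP n y - P.vecA n y = n * (α * P.p₀ - P.a₀)
      + y * ((α * P.p₀ - P.a₀) + (α * P.p₁ - P.a₁)) := by
    unfold vecP vecA; push_cast; ring
  rw [this]
  have : 0 ≤ (α * P.p₀ - P.a₀) + (α * P.p₁ - P.a₁) := by linarith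
  positivity

lemma p₁_mul_vec_side_le {n y : ℕ} (hy : y < n) :
    P.p₁ * (α * P.vecP n y - P.vecA n y) ≤ 2 * n := by
  have h₁ : (y : ℝ) ≤ n := by exact_mod_cast hy.le
  have h₂ := P.pos_side
  have h₃ := P.neg_side
  have hy : (0 : ℝ) ≤ y := by positivity
  have hp : (0 : ℝ) < P.p₁ := by exact_mod_cast P.p₁_pos
  have : α * P.vecP n y - P.vecA n y ≤ 2 * n * (α * P.p₀ - P.a₀) := by
    have h₄ : α * P.vecP n y - P.vecA n y = (n + y) * (α * P.p₀ - P.a₀)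
        + y * (α * P.p₁ - P.a₁) := by
      unfold vecP vecA; push_cast; ring
    rw [h₄]
    nlinarith
  calc P.p₁ * (α * P.vecP n y - P.vecA n y) ≤ P.p₁ * (2 * n * (α * P.p₀ - P.a₀)) := by gcongr
    _ = 2 * n * (P.p₁ * (α * P.p₀ - P.a₀)) := by ring
    _ ≤ 2 * n * 1 := by gcongr; exact P.mul_pos_side_le
    _ = _ := by ring

lemma vec_side_mul_le {n y : ℕ} (hn : 1 ≤ n) (hy : y < n) :
    P.vecP n y * (α * P.vecP n y - P.vecA n y) ≤ 6 * (n : ℝ) ^ 2 := by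
  have h₁ := P.vec_side_pos (y := y) hn
  have h₂ : (P.vecP n y : ℝ) ≤ 3 * n * P.p₁ := by exact_mod_cast P.vecP_le hy
  calc P.vecP n y * (α * P.vecP n y - P.vecA n y)
      ≤ 3 * n * P.p₁ * (α * P.vecP n y - P.vecA n y) := by gcongr
    _ = 3 * n * (P.p₁ * (α * P.vecP n y - P.vecA n y)) := by ring
    _ ≤ 3 * n * (2 * n) := mul_le_mul_of_nonneg_left (P.p₁_mul_vec_side_le hy) (by positivity)
    _ = _ := by ring

lemma vec_ne_of_lt {P : ℕ → ApproxPair α} (hp : ∀ i, 1 ≤ (P i).p₀)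
    (hstep : ∀ i, ∃ t : ℤ, 1 ≤ t ∧ (P (i + 1)).p₀ = (P i).p₀ + t * (P i).p₁ ∧
        (P (i + 1)).a₀ = (P i).a₀ + t * (P i).a₁)
    {i j n y n' y' : ℕ} (hij : i < j) (hn : 1 ≤ n) (hn' : 1 ≤ n')
    (heqp : (P i).vecP n y = (P j).vecP n' y') : (P i).vecA n y ≠ (P j).vecA n' y' := by
  intro heqa
  have hpr : ∀ i, (0 : ℝ) < (P i).p₀ := fun i => by
    have := hp i
    exact_mod_cast (by omega : 0 < (P i).p₀)
  have key : ∀ i n y : ℕ, 1 ≤ n →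
      ((P i).vecA n y : ℝ) / (P i).vecP n y < (P (i + 1)).a₀ / (P (i + 1)).p₀ := by
    intro i n y hn
    obtain ⟨t, ht, h₁, h₂⟩ := hstep i
    have hv : (0 : ℝ) < (P i).vecP n y := by exact_mod_cast (P i).vecP_pos hn (hp i)
    rw [div_lt_div_iff₀ hv (hpr _)]
    have h₃ := (P i).vec_det_left n y
    have h₄ := (P i).vec_det_right n y
    have : (P i).vecA n y * (P (i + 1)).p₀ < (P (i + 1)).a₀ * (P i).vecP n y := by
      rw [h₁, h₂]
      have hn1 : (1 : ℤ) ≤ n := by exact_mod_cast hn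
      have hy0 : (0 : ℤ) ≤ y := by positivity
      nlinarith
    exact_mod_cast this
  have hmono : Monotone fun i => ((P i).a₀ : ℝ) / (P i).p₀ := by
    refine monotone_nat_of_le_succ fun i => ?_
    have := (key i 1 0 le_rfl).le
    simpa [vecA, vecP] using this
  have h₁ := key i n y hn
  have h₂ : ((P (i + 1)).a₀ : ℝ) / (P (i + 1)).p₀ ≤ (P j).a₀ / (P j).p₀ :=
    hmono (Nat.succ_le_of_lt hij)
  have h₃ : ((P j).a₀ : ℝ) / (P j).p₀ ≤ (P j).vecA n' y' / (P j).vecP n' y' := by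
    have hv : (0 : ℝ) < (P j).vecP n' y' := by exact_mod_cast (P j).vecP_pos hn' (hp j)
    rw [div_le_div_iff₀ (hpr j) hv]
    have h₄ := (P j).vec_det_left n' y'
    have : (P j).a₀ * (P j).vecP n' y' ≤ (P j).vecA n' y' * (P j).p₀ := by
      have hy0 : (0 : ℤ) ≤ y' := by positivity
      linarith
    exact_mod_cast this
  rw [heqp, heqa] at h₁
  linarith

end ApproxPair

/-- A large finite family of coprime approximations `round (α * q) / q` to `α`, with denominators
between `2 ^ (20 * m)` and `2 ^ (B * m)`. -/
def IsGoodFamily (α c : ℝ) (B m : ℕ) (S : Finset ℕ) : Prop :=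
  (∀ q ∈ S, 2 ^ (20 * m) ≤ q ∧ q ≤ 2 ^ (B * m) ∧ (q : ℝ) * nint (α * q) ≤ 6 * 4 ^ m ∧
    nint (α * q) * 2 ^ (21 * m) ≤ 2 ∧ IsCoprime (q : ℤ) (round (α * q))) ∧
  c * (m : ℝ) ^ 2 ≤ ∑ q ∈ S, 1 / ((q : ℝ) * nint (α * q))

lemma BadlyApprox.exists_isGoodFamily {α δ : ℝ} (h : BadlyApprox α δ) (hδ : 0 < δ) :
    ∃ B m₀ : ℕ, 3 ≤ B ∧ ∀ m, m₀ ≤ m → ∃ S, IsGoodFamily α (1 / 24) B m S := by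
  obtain ⟨P, L, hP⟩ := ApproxPair.exists_seq h hδ
  obtain ⟨m₁, hm₁⟩ := pow_unbounded_of_one_lt (2 / δ) (one_lt_two : (1 : ℝ) < 2)
  refine ⟨3 + L * 23, m₁ + 1, by omega, fun m hm => ?_⟩
  have hm1 : 1 ≤ m := by omega
  let idx : Finset (ℕ × (Σ _ : ℕ, ℕ)) := Finset.Ico (22 * m) (23 * m) ×ˢ
    (Finset.Icc 1 (2 ^ m)).sigma fun n => (Finset.range n).filter n.Coprime
  let F : ℕ × (Σ _ : ℕ, ℕ) → ℕ := fun x => ((P x.1).vecP x.2.1 x.2.2).toNat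
  have hmem : ∀ x ∈ idx, (22 * m ≤ x.1 ∧ x.1 < 23 * m) ∧ (1 ≤ x.2.1 ∧ x.2.1 ≤ 2 ^ m) ∧
      x.2.2 < x.2.1 ∧ Nat.Coprime x.2.1 x.2.2 := by
    rintro ⟨i, n, y⟩ hx
    simpa [idx, and_assoc] using hx
  have hF : ∀ x ∈ idx, (F x : ℤ) = (P x.1).vecP x.2.1 x.2.2 := fun x hx =>
    Int.toNat_of_nonneg ((P x.1).vecP_pos (hmem x hx).2.1.1 (hP x.1).1).le
  have hFr : ∀ x ∈ idx, (F x : ℝ) = (P x.1).vecP x.2.1 x.2.2 := fun x hx => by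
    rw [← hF x hx, Int.cast_natCast]
  have hFpos : ∀ x ∈ idx, 0 < F x := fun x hx => by
    have := (P x.1).vecP_pos (y := x.2.2) (hmem x hx).2.1.1 (hP x.1).1
    have := hF x hx
    omega
  have hside : ∀ x ∈ idx, 0 < α * F x - (P x.1).vecA x.2.1 x.2.2 := fun x hx => by
    rw [hFr x hx]
    exact (P x.1).vec_side_pos (hmem x hx).2.1.1
  have hside_le : ∀ x ∈ idx, (α * F x - (P x.1).vecA x.2.1 x.2.2) * 2 ^ (21 * m) ≤ 2 := by
    intro x hx
    obtain ⟨⟨hi, -⟩, ⟨-, hn⟩, hy, -⟩ := hmem x hx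
    have h₁ := (P x.1).p₁_mul_vec_side_le hy
    rw [← hFr x hx] at h₁
    have h₂ : (2 : ℝ) ^ (22 * m) ≤ (P x.1).p₁ := by
      have := (pow_le_pow_right₀ (by norm_num : (1 : ℤ) ≤ 2) hi).trans (hP x.1).2.1
      exact_mod_cast this
    have h₃ : (x.2.1 : ℝ) ≤ 2 ^ m := by exact_mod_cast hn
    have h₄ : (2 : ℝ) ^ (22 * m) = 2 ^ m * 2 ^ (21 * m) := by rw [← pow_add]; congr 1; ring
    have h₅ := mul_le_mul_of_nonneg_right h₂ (hside x hx).le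
    have h₆ : (2 : ℝ) ^ m * ((α * F x - (P x.1).vecA x.2.1 x.2.2) * 2 ^ (21 * m)) ≤ 2 ^ m * 2 := by
      rw [h₄] at h₅
      linarith
    exact le_of_mul_le_mul_left h₆ (by positivity)
  have hround : ∀ x ∈ idx, round (α * F x) = (P x.1).vecA x.2.1 x.2.2 ∧
      nint (α * F x) = α * F x - (P x.1).vecA x.2.1 x.2.2 := by
    intro x hx
    have h₁ : |α * F x - (P x.1).vecA x.2.1 x.2.2| < 1 / 2 := by
      rw [abs_of_pos (hside x hx)]
      have h₂ := hside_le x hx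
      have h₃ : (2 : ℝ) ^ 21 ≤ 2 ^ (21 * m) := pow_le_pow_right₀ (by norm_num) (by omega)
      nlinarith [hside x hx]
    obtain ⟨h₂, h₃⟩ := nint_eq_of_abs_sub_lt h₁
    exact ⟨h₂, h₃.trans (abs_of_pos (hside x hx))⟩
  have hinj : Set.InjOn F idx := by
    intro x hx x' hx' hxx
    rw [Finset.mem_coe] at hx hx'
    have hp : (P x.1).vecP x.2.1 x.2.2 = (P x'.1).vecP x'.2.1 x'.2.2 := by
      rw [← hF x hx, ← hF x' hx', hxx]
    have ha : (P x.1).vecA x.2.1 x.2.2 = (P x'.1).vecA x'.2.1 x'.2.2 := by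
      rw [← (hround x hx).1, ← (hround x' hx').1, hxx]
    have hn := (hmem x hx).2.1.1
    have hn' := (hmem x' hx').2.1.1
    have hi : x.1 = x'.1 := by
      rcases lt_trichotomy x.1 x'.1 with hlt | heq | hlt
      · exact absurd ha (ApproxPair.vec_ne_of_lt (fun i => (hP i).1) (fun i => (hP i).2.2.2) hlt
          hn hn' hp)
      · exact heq
      · exact absurd ha.symm (ApproxPair.vec_ne_of_lt (fun i => (hP i).1)
          (fun i => (hP i).2.2.2) hlt hn' hn hp.symm)
    rw [hi] at hp ha
    obtain ⟨h₁, h₂⟩ := (P x'.1).vec_inj hp ha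
    obtain ⟨i, n, y⟩ := x
    obtain ⟨i', n', y'⟩ := x'
    simp only at hi h₁ h₂
    subst hi h₁ h₂
    rfl
  have hprod : ∀ x ∈ idx, (F x : ℝ) * nint (α * F x) ≤ 6 * (x.2.1 : ℝ) ^ 2 := by
    intro x hx
    rw [(hround x hx).2, hFr x hx]
    exact (P x.1).vec_side_mul_le (hmem x hx).2.1.1 (hmem x hx).2.2.1
  refine ⟨idx.image F, ?_, ?_⟩
  · intro q hq
    obtain ⟨x, hx, rfl⟩ := Finset.mem_image.mp hq
    obtain ⟨⟨-, hi⟩, ⟨hn1, hn⟩, hy, hco⟩ := hmem x hx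
    have hsmall : nint (α * F x) * 2 ^ (21 * m) ≤ 2 := by
      rw [(hround x hx).2]; exact hside_le x hx
    have hnr : (x.2.1 : ℝ) ≤ 2 ^ m := by exact_mod_cast hn
    refine ⟨?_, ?_, ?_, hsmall, ?_⟩
    · have h₁ := h _ (hFpos x hx)
      have h₂ : (2 : ℝ) ^ (20 * m) ≤ F x := by
        have h₃ : 2 / δ ≤ 2 ^ m := hm₁.le.trans (pow_le_pow_right₀ (by norm_num) (by omega))
        rw [div_le_iff₀ hδ] at h₃
        have h₄ : (2 : ℝ) ^ (21 * m) = 2 ^ m * 2 ^ (20 * m) := by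
          rw [← pow_add]; congr 1; ring
        have h₅ : δ * 2 ^ (21 * m) ≤ F x * 2 := by
          calc δ * 2 ^ (21 * m) ≤ F x * nint (α * F x) * 2 ^ (21 * m) := by gcongr
            _ = F x * (nint (α * F x) * 2 ^ (21 * m)) := by ring
            _ ≤ _ := by gcongr
        rw [h₄] at h₅
        have h₆ : (0 : ℝ) < 2 ^ (20 * m) := by positivity
        nlinarith
      exact_mod_cast h₂
    · have h₁ := (P x.1).vecP_le hy
      have h₂ : (P x.1).p₁ ≤ 2 ^ (L * (23 * m)) :=
        (hP x.1).2.2.1.trans (pow_le_pow_right₀ (by norm_num) (Nat.mul_le_mul_left _ (by omega)))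
      have h₃ : (x.2.1 : ℤ) ≤ 2 ^ m := by exact_mod_cast hn
      have h₄ : (F x : ℤ) ≤ 2 ^ ((3 + L * 23) * m) := by
        calc (F x : ℤ) ≤ 3 * x.2.1 * (P x.1).p₁ := by rw [hF x hx]; exact h₁
          _ ≤ 2 ^ (2 * m) * 2 ^ m * 2 ^ (L * (23 * m)) := by
              have h₅ : (3 : ℤ) ≤ 2 ^ (2 * m) := by
                calc (3 : ℤ) ≤ 2 ^ 2 := by norm_num
                  _ ≤ _ := pow_le_pow_right₀ (by norm_num) (by omega)
              have := (P x.1).p₁_pos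
              gcongr
          _ = _ := by rw [← pow_add, ← pow_add]; congr 1; ring
      exact_mod_cast h₄
    · refine (hprod x hx).trans ?_
      have : (4 : ℝ) ^ m = (2 ^ m) ^ 2 := by rw [← pow_mul, mul_comm, pow_mul]; norm_num
      rw [this]
      gcongr
    · rw [(hround x hx).1, hF x hx]
      exact (P x.1).vec_isCoprime hco
  · rw [Finset.sum_image hinj]
    have hharm : (1 / 2 : ℝ) * m ≤ ∑ n ∈ Finset.Icc (1 : ℕ) (2 ^ m), (1 : ℝ) / n := by
      have h₁ := log_add_one_le_harmonic (2 ^ m)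
      rw [harmonic_eq_sum_Icc] at h₁
      push_cast at h₁
      have h₂ : Real.log ((2 : ℝ) ^ m) ≤ Real.log (2 ^ m + 1) :=
        Real.log_le_log (by positivity) (by linarith)
      rw [Real.log_pow] at h₂
      have h₃ := Real.log_two_gt_d9
      have h₄ : (0 : ℝ) ≤ m := by positivity
      simp only [one_div] at h₁ ⊢
      nlinarith
    have htot := sum_one_div_le_two_mul_sum_totient (2 ^ m)
    calc 1 / 24 * (m : ℝ) ^ 2
        ≤ m * (1 / 6 * ∑ n ∈ Finset.Icc (1 : ℕ) (2 ^ m), (Nat.totient n : ℝ) / (n : ℝ) ^ 2) := by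
          have h₄ : (0 : ℝ) ≤ m := by positivity
          nlinarith
      _ = ∑ x ∈ idx, 1 / (6 * (x.2.1 : ℝ) ^ 2) := by
          rw [Finset.sum_product]
          simp only
          rw [Finset.sum_const, Nat.card_Ico, Finset.sum_sigma, nsmul_eq_mul,
            show 23 * m - 22 * m = m by omega, Finset.mul_sum]
          congr 1
          refine Finset.sum_congr rfl fun n _ => ?_
          simp only
          rw [Finset.sum_const, ← Nat.totient_eq_card_coprime, nsmul_eq_mul]
          ring
      _ ≤ ∑ x ∈ idx, 1 / ((F x : ℝ) * nint (α * F x)) := by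
          refine Finset.sum_le_sum fun x hx => ?_
          exact one_div_le_one_div_of_le (h.mul_nint_pos hδ (hFpos x hx)) (hprod x hx)

/-! ### Quasi-independence of the sets `nearSet q r` -/

/-- `N` times the Fejér kernel. -/
noncomputable def fejerSum (N : ℕ) (t : ℝ) : ℝ :=
  ∑ p ∈ Finset.range N ×ˢ Finset.range N, Real.cos (2 * Real.pi * (((p.1 : ℤ) - p.2 : ℤ) * t))

lemma fejerSum_nonneg (N : ℕ) (t : ℝ) : 0 ≤ fejerSum N t := by
  have : fejerSum N t = (∑ i ∈ Finset.range N, Real.cos (2 * Real.pi * (i * t))) ^ 2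
      + (∑ i ∈ Finset.range N, Real.sin (2 * Real.pi * (i * t))) ^ 2 := by
    rw [fejerSum, Finset.sum_product, sq, sq, Finset.sum_mul_sum, Finset.sum_mul_sum,
      ← Finset.sum_add_distrib]
    refine Finset.sum_congr rfl fun i _ => ?_
    rw [← Finset.sum_add_distrib]
    refine Finset.sum_congr rfl fun j _ => ?_
    rw [← Real.cos_sub]
    congr 1
    push_cast
    ring
  rw [this]
  positivity

lemma half_sq_le_fejerSum {N : ℕ} {t : ℝ} (hN : 0 < N) (ht : nint t ≤ 1 / (8 * N)) :
    (N : ℝ) ^ 2 / 2 ≤ fejerSum N t := by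
  have hN' : (0 : ℝ) < N := by exact_mod_cast hN
  have key : ∀ p ∈ Finset.range N ×ˢ Finset.range N,
      (1 / 2 : ℝ) ≤ Real.cos (2 * Real.pi * (((p.1 : ℤ) - p.2 : ℤ) * t)) := by
    intro p hp
    rw [Finset.mem_product, Finset.mem_range, Finset.mem_range] at hp
    set k : ℤ := (p.1 : ℤ) - p.2 with hk
    have hk' : |(k : ℝ)| ≤ N := by
      have : |k| ≤ N := by rw [abs_le]; omega
      exact_mod_cast this
    have h₁ : 2 * Real.pi * ((k : ℝ) * t)
        = 2 * Real.pi * (k * (t - round t)) + ((k * round t : ℤ) : ℝ) * (2 * Real.pi) := by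
      push_cast; ring
    rw [h₁, Real.cos_add_int_mul_two_pi]
    have h₂ : |(k : ℝ) * (t - round t)| ≤ 1 / 8 := by
      rw [abs_mul]
      calc |(k : ℝ)| * |t - round t| ≤ N * (1 / (8 * N)) := by
            gcongr
            exact ht
        _ = 1 / 8 := by field_simp
    have h₃ : (2 * Real.pi * ((k : ℝ) * (t - round t))) ^ 2 ≤ 1 := by
      have h₄ : ((k : ℝ) * (t - round t)) ^ 2 ≤ (1 / 8) ^ 2 := sq_le_sq' (by
        linarith [(abs_le.mp h₂).1]) (abs_le.mp h₂).2
      rw [mul_pow, mul_pow]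
      have h₅ : Real.pi ^ 2 ≤ 16 := by nlinarith [Real.pi_pos, Real.pi_le_four]
      nlinarith [sq_nonneg ((k : ℝ) * (t - round t)), sq_nonneg Real.pi]
    linarith [Real.one_sub_sq_div_two_le_cos (x := 2 * Real.pi * ((k : ℝ) * (t - round t)))]
  have := Finset.card_nsmul_le_sum _ _ _ key
  rw [Finset.card_product, Finset.card_range, nsmul_eq_mul] at this
  rw [Nat.cast_mul] at this
  rw [fejerSum]
  linarith

lemma abs_integral_cos_le {w : ℝ} (hw : w ≠ 0) (u v : ℝ) :
    |∫ x in u..v, Real.cos (2 * Real.pi * (w * x))| ≤ 1 / |w| := by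
  have hw' : 2 * Real.pi * w ≠ 0 := mul_ne_zero (by positivity) hw
  have h₁ : ∫ x in u..v, Real.cos (2 * Real.pi * (w * x))
      = (Real.sin (2 * Real.pi * w * v) - Real.sin (2 * Real.pi * w * u)) / (2 * Real.pi * w) := by
    simp_rw [← mul_assoc]
    rw [intervalIntegral.integral_comp_mul_left _ hw', integral_cos, smul_eq_mul]
    ring
  rw [h₁, abs_div, abs_mul, abs_of_pos (by positivity : 0 < 2 * Real.pi)]
  have hw0 : 0 < |w| := abs_pos.mpr hw
  have h₂ : |Real.sin (2 * Real.pi * w * v) - Real.sin (2 * Real.pi * w * u)| ≤ 2 := by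
    rw [abs_le]
    constructor <;> linarith [Real.sin_le_one (2 * Real.pi * w * v),
      Real.neg_one_le_sin (2 * Real.pi * w * v), Real.sin_le_one (2 * Real.pi * w * u),
      Real.neg_one_le_sin (2 * Real.pi * w * u)]
  rw [div_le_div_iff₀ (by positivity) hw0]
  nlinarith [Real.pi_gt_three]

lemma volume_inter_nearSet_inter_nearSet_le {q q' N N' : ℕ} {u h : ℝ} (hh : 0 < h) (hN : 0 < N)
    (hN' : 0 < N')
    (hsep : ∀ n n' : ℤ, |n| < N → |n'| < N' → (n ≠ 0 ∨ n' ≠ 0) →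
      (N : ℝ) * N' / h ≤ |(n : ℝ) * q + n' * q'|) :
    MeasureTheory.volume.real
      (Set.Ico u (u + h) ∩ (nearSet q (1 / (8 * N)) ∩ nearSet q' (1 / (8 * N'))))
      ≤ 8 * h / (N * N') := by
  have hNr : (0 : ℝ) < N := by exact_mod_cast hN
  have hNr' : (0 : ℝ) < N' := by exact_mod_cast hN'
  have hcont : Continuous fun x : ℝ => fejerSum N (x * q) * fejerSum N' (x * q') := by
    unfold fejerSum; fun_prop
  have hterm : ∀ n n' : ℤ, |n| < N → |n'| < N' →
      ∫ x in u..u + h, Real.cos (2 * Real.pi * (n * (x * q))) *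
        Real.cos (2 * Real.pi * (n' * (x * q')))
      ≤ (if n = 0 then 1 else 0) * (if n' = 0 then 1 else 0) * h + h / (N * N') := by
    intro n n' hn hn'
    by_cases h0 : n = 0 ∧ n' = 0
    · simp only [h0.1, h0.2, Int.cast_zero, zero_mul, mul_zero, Real.cos_zero, mul_one,
        intervalIntegral.integral_const, smul_eq_mul, if_true, one_mul]
      have : 0 ≤ h / (N * N') := by positivity
      linarith
    · have hne : n ≠ 0 ∨ n' ≠ 0 := by tauto
      have hz : ((if n = 0 then 1 else 0) * (if n' = 0 then 1 else 0) : ℝ) = 0 := by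
        rcases hne with h1 | h1 <;> simp [h1]
      rw [hz, zero_mul, zero_add]
      have hcos : ∀ x : ℝ, Real.cos (2 * Real.pi * (n * (x * q))) *
          Real.cos (2 * Real.pi * (n' * (x * q'))) =
          1 / 2 * Real.cos (2 * Real.pi * (((n : ℝ) * q + n' * q') * x)) +
          1 / 2 * Real.cos (2 * Real.pi * (((n : ℝ) * q + (-n' : ℤ) * q') * x)) := by
        intro x
        have e₁ : 2 * Real.pi * (((n : ℝ) * q + n' * q') * x)
          = 2 * Real.pi * (n * (x * q)) + 2 * Real.pi * (n' * (x * q')) := by ring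
        have e₂ : 2 * Real.pi * (((n : ℝ) * q + (-n' : ℤ) * q') * x)
          = 2 * Real.pi * (n * (x * q)) - 2 * Real.pi * (n' * (x * q')) := by push_cast; ring
        rw [e₁, e₂, Real.cos_add, Real.cos_sub]
        ring
      have hbound : ∀ w : ℝ, (N : ℝ) * N' / h ≤ |w| →
          ∫ x in u..u + h, Real.cos (2 * Real.pi * (w * x)) ≤ h / (N * N') := by
        intro w hw
        have hpos : 0 < (N : ℝ) * N' / h := by positivity
        have hw0 : w ≠ 0 := abs_pos.mp (hpos.trans_le hw)
        refine (le_abs_self _).trans ((abs_integral_cos_le hw0 _ _).trans ?_)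
        rw [← one_div_div ((N : ℝ) * N') h]
        exact one_div_le_one_div_of_le hpos hw
      have h₁ := hbound _ (hsep n n' hn hn' hne)
      have h₂ := hbound _ (hsep n (-n') hn (by rwa [abs_neg]) (by
        rcases hne with h1 | h1
        · exact Or.inl h1
        · exact Or.inr (neg_ne_zero.mpr h1)))
      simp_rw [hcos]
      rw [intervalIntegral.integral_add (Continuous.intervalIntegrable (by fun_prop) _ _)
        (Continuous.intervalIntegrable (by fun_prop) _ _),
        intervalIntegral.integral_const_mul, intervalIntegral.integral_const_mul]
      linarith
  have hcount : ∀ M : ℕ, ∑ p ∈ Finset.range M ×ˢ Finset.range M,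
      (if (p.1 : ℤ) - p.2 = 0 then (1 : ℝ) else 0) = M := by
    intro M
    rw [Finset.sum_product]
    calc _ = ∑ i ∈ Finset.range M, (1 : ℝ) := by
          refine Finset.sum_congr rfl fun i hi => ?_
          simp only [sub_eq_zero, Nat.cast_inj]
          rw [Finset.sum_ite_eq, if_pos hi]
      _ = M := by simp
  have habs : ∀ M : ℕ, ∀ p ∈ Finset.range M ×ˢ Finset.range M, |(p.1 : ℤ) - p.2| < M := by
    intro M p hp
    rw [Finset.mem_product, Finset.mem_range, Finset.mem_range] at hp
    rw [abs_lt]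
    omega
  have hintegral : ∫ x in u..u + h, fejerSum N (x * q) * fejerSum N' (x * q') ≤ 2 * (N * N') * h := by
    have hexp : ∀ x : ℝ, fejerSum N (x * q) * fejerSum N' (x * q') =
        ∑ p ∈ Finset.range N ×ˢ Finset.range N, ∑ p' ∈ Finset.range N' ×ˢ Finset.range N',
          Real.cos (2 * Real.pi * (((p.1 : ℤ) - p.2 : ℤ) * (x * q))) *
            Real.cos (2 * Real.pi * (((p'.1 : ℤ) - p'.2 : ℤ) * (x * q'))) := fun x => by
      rw [fejerSum, fejerSum, Finset.sum_mul_sum]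
    simp_rw [hexp]
    rw [intervalIntegral.integral_finsetSum
      fun p _ => Continuous.intervalIntegrable (by fun_prop) _ _]
    calc _ ≤ ∑ p ∈ Finset.range N ×ˢ Finset.range N, ∑ p' ∈ Finset.range N' ×ˢ Finset.range N',
          ((if (p.1 : ℤ) - p.2 = 0 then 1 else 0) * (if (p'.1 : ℤ) - p'.2 = 0 then 1 else 0) * h
            + h / (N * N')) := by
          refine Finset.sum_le_sum fun p hp => ?_
          rw [intervalIntegral.integral_finsetSum
            fun p _ => Continuous.intervalIntegrable (by fun_prop) _ _]
          exact Finset.sum_le_sum fun p' hp' => hterm _ _ (habs N p hp) (habs N' p' hp')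
      _ = 2 * (N * N') * h := by
          simp_rw [Finset.sum_add_distrib, ← Finset.sum_mul]
          rw [← Finset.sum_mul_sum, hcount, hcount]
          simp only [Finset.sum_const, Finset.card_product, Finset.card_range, nsmul_eq_mul]
          push_cast
          field_simp
          ring
  set E := Set.Ico u (u + h) ∩ (nearSet q (1 / (8 * N)) ∩ nearSet q' (1 / (8 * N'))) with hE
  have hintI : MeasureTheory.IntegrableOn
      (fun x : ℝ => fejerSum N (x * q) * fejerSum N' (x * q')) (Set.Ico u (u + h)) :=
    (hcont.continuousOn.integrableOn_compact isCompact_Icc).mono_set Set.Ico_subset_Icc_self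
  have hEm : MeasurableSet E := measurableSet_Ico.inter
    ((measurableSet_nearSet _ _).inter (measurableSet_nearSet _ _))
  have hEsub : E ⊆ Set.Ico u (u + h) := Set.inter_subset_left
  have hEfin : MeasureTheory.volume E ≠ ⊤ :=
    ne_top_of_le_ne_top (by simp) (MeasureTheory.measure_mono hEsub)
  have hmarkov : (N : ℝ) ^ 2 / 2 * ((N' : ℝ) ^ 2 / 2) * MeasureTheory.volume.real E ≤
      2 * (N * N') * h := by
    refine (MeasureTheory.setIntegral_ge_of_const_le_real hEm hEfin (fun x hx => ?_)
      (hintI.mono_set hEsub)).trans ((MeasureTheory.setIntegral_mono_set hintI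
        (Filter.Eventually.of_forall fun x => ?_) (Filter.Eventually.of_forall hEsub)).trans ?_)
    · exact mul_le_mul (half_sq_le_fejerSum hN hx.2.1) (half_sq_le_fejerSum hN' hx.2.2)
        (by positivity) (fejerSum_nonneg _ _)
    · exact mul_nonneg (fejerSum_nonneg _ _) (fejerSum_nonneg _ _)
    · rw [MeasureTheory.integral_Ico_eq_integral_Ioc,
        ← intervalIntegral.integral_of_le (by linarith)]
      exact hintegral
  rw [le_div_iff₀ (by positivity)]
  have h₁ : (N : ℝ) * N' * (MeasureTheory.volume.real E * (N * N')) ≤ N * N' * (8 * h) := by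
    linarith
  exact le_of_mul_le_mul_left h₁ (by positivity)

/-! ### Measure of `nearSet q r` in an interval -/

lemma volume_inter_nearSet_le {q : ℕ} {u h ρ : ℝ} (hρ : 0 ≤ ρ) (hq : 1 ≤ q * h) (hh : 0 < h) :
    MeasureTheory.volume.real (Set.Ico u (u + h) ∩ nearSet q ρ) ≤ 8 * ρ * h := by
  have hq0 : (0 : ℝ) < q := by
    by_contra hcon
    nlinarith
  set J := Finset.Icc ⌈u * q - 1 / 2⌉ ⌊(u + h) * q + 1 / 2⌋ with hJ
  have hsub : Set.Ico u (u + h) ∩ nearSet q ρ ⊆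
      ⋃ p ∈ J, Set.Icc (((p : ℝ) - ρ) / q) ((p + ρ) / q) := by
    rintro x ⟨⟨hx₁, hx₂⟩, hx₃⟩
    simp only [Set.mem_iUnion]
    have h₁ := abs_le.mp (abs_sub_round (x * q))
    have h₂ := abs_le.mp (show |x * q - round (x * q)| ≤ ρ from hx₃)
    have h₃ : u * q ≤ x * q := by gcongr
    have h₄ : x * q ≤ (u + h) * q := by gcongr
    refine ⟨round (x * q), ?_, ?_⟩
    · rw [hJ, Finset.mem_Icc, Int.ceil_le, Int.le_floor]
      constructor <;> linarith
    · rw [Set.mem_Icc, div_le_iff₀ hq0, le_div_iff₀ hq0]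
      constructor <;> linarith
  have hcard : (J.card : ℝ) ≤ 3 * (q * h) := by
    rw [hJ, Int.card_Icc]
    have h₁ := Int.floor_le ((u + h) * q + 1 / 2)
    have h₂ := Int.le_ceil (u * q - 1 / 2)
    have h₃ : (((⌊(u + h) * q + 1 / 2⌋ + 1 - ⌈u * q - 1 / 2⌉).toNat : ℕ) : ℝ)
        = max ((⌊(u + h) * q + 1 / 2⌋ + 1 - ⌈u * q - 1 / 2⌉ : ℤ) : ℝ) 0 := by
      exact_mod_cast Int.toNat_eq_max _
    rw [h₃]
    push_cast
    refine max_le ?_ (by positivity)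
    nlinarith
  calc MeasureTheory.volume.real (Set.Ico u (u + h) ∩ nearSet q ρ)
      ≤ MeasureTheory.volume.real (⋃ p ∈ J, Set.Icc (((p : ℝ) - ρ) / q) ((p + ρ) / q)) :=
        MeasureTheory.measureReal_mono hsub
          (ne_top_of_lt (MeasureTheory.measure_biUnion_lt_top J.finite_toSet (by simp)))
    _ ≤ ∑ p ∈ J, MeasureTheory.volume.real (Set.Icc (((p : ℝ) - ρ) / q) ((p + ρ) / q)) :=
        MeasureTheory.measureReal_biUnion_finset_le _ _
    _ = ∑ p ∈ J, 2 * ρ / q := by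
        refine Finset.sum_congr rfl fun p _ => ?_
        rw [Real.volume_real_Icc_of_le (by gcongr; linarith)]
        ring
    _ = J.card * (2 * ρ / q) := by rw [Finset.sum_const, nsmul_eq_mul]
    _ ≤ 3 * (q * h) * (2 * ρ / q) := by gcongr
    _ = 6 * (ρ * h) := by field_simp; ring
    _ ≤ 8 * ρ * h := by nlinarith [mul_nonneg hρ hh.le]

lemma le_volume_inter_nearSet {q : ℕ} {u h ρ : ℝ} (hρ : 0 ≤ ρ) (hρ1 : ρ ≤ 1) (hq : 4 ≤ q * h)
    (hh : 0 < h) :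
    ρ * h / 2 ≤ MeasureTheory.volume.real (Set.Ico u (u + h) ∩ nearSet q ρ) := by
  have hq0 : (0 : ℝ) < q := by
    by_contra hcon
    nlinarith
  set J := Finset.Ico ⌈u * q⌉ ⌊(u + h) * q⌋ with hJ
  have hsub : ⋃ p ∈ J, Set.Ico ((p : ℝ) / q) ((p + ρ) / q) ⊆ Set.Ico u (u + h) ∩ nearSet q ρ := by
    intro x hx
    simp only [Set.mem_iUnion] at hx
    obtain ⟨p, hp, hx⟩ := hx
    rw [Set.mem_Ico, div_le_iff₀ hq0, lt_div_iff₀ hq0] at hx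
    rw [hJ, Finset.mem_Ico, Int.ceil_le] at hp
    have h₁ : (p : ℝ) + 1 ≤ (u + h) * q := by
      exact_mod_cast Int.le_floor.mp (Int.add_one_le_iff.mpr hp.2)
    refine ⟨⟨le_of_mul_le_mul_right (hp.1.trans hx.1) hq0,
      lt_of_mul_lt_mul_right (by linarith : x * q < (u + h) * q) hq0.le⟩, ?_⟩
    refine (nint_le_abs_sub _ p).trans ?_
    rw [abs_le]
    constructor <;> linarith
  have hcard : q * h / 2 ≤ (J.card : ℝ) := by
    rw [hJ, Int.card_Ico]
    have h₁ := Int.lt_floor_add_one ((u + h) * q)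
    have h₂ := Int.ceil_lt_add_one (u * q)
    have h₃ : (((⌊(u + h) * q⌋ - ⌈u * q⌉ : ℤ)) : ℝ) ≤ ((⌊(u + h) * q⌋ - ⌈u * q⌉).toNat : ℕ) := by
      exact_mod_cast Int.self_le_toNat _
    push_cast at h₃
    nlinarith
  have hdisj : Set.PairwiseDisjoint (J : Set ℤ)
      fun p : ℤ => Set.Ico ((p : ℝ) / q) ((p + ρ) / q) := by
    intro p _ p' _ hne
    refine Set.disjoint_left.mpr fun x hx hx' => hne ?_
    rw [Set.mem_Ico, div_le_iff₀ hq0, lt_div_iff₀ hq0] at hx hx'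
    have h₁ : (p : ℝ) < p' + 1 := by linarith
    have h₂ : (p' : ℝ) < p + 1 := by linarith
    have h₃ : p < p' + 1 := by exact_mod_cast h₁
    have h₄ : p' < p + 1 := by exact_mod_cast h₂
    omega
  calc ρ * h / 2 = q * h / 2 * (ρ / q) := by field_simp
    _ ≤ J.card * (ρ / q) := by gcongr
    _ = ∑ p ∈ J, MeasureTheory.volume.real (Set.Ico ((p : ℝ) / q) ((p + ρ) / q)) := by
        rw [← nsmul_eq_mul, ← Finset.sum_const]
        refine Finset.sum_congr rfl fun p _ => ?_
        rw [Real.volume_real_Ico_of_le (by gcongr; linarith)]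
        ring
    _ = MeasureTheory.volume.real (⋃ p ∈ J, Set.Ico ((p : ℝ) / q) ((p + ρ) / q)) :=
        (MeasureTheory.measureReal_biUnion_finset hdisj (fun _ _ => measurableSet_Ico)
          (by simp)).symm
    _ ≤ _ := MeasureTheory.measureReal_mono hsub
        (ne_top_of_le_ne_top (by simp) (MeasureTheory.measure_mono Set.inter_subset_left))

/-! ### Many points lie close to a rational with denominator in a good family -/

lemma sub_sum_measure_inter_le_measure_biUnion {Ω ι : Type*} [MeasurableSpace Ω]
    (ν : MeasureTheory.Measure Ω) [MeasureTheory.IsFiniteMeasure ν] (S : Finset ι)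
    {E : ι → Set Ω} (hE : ∀ i ∈ S, MeasurableSet (E i)) (a : ℝ) :
    2 * a * ∑ i ∈ S, ν.real (E i) - a ^ 2 * ∑ i ∈ S, ∑ j ∈ S, ν.real (E i ∩ E j) ≤
      ν.real (⋃ i ∈ S, E i) := by
  have hone : ∀ A : Set Ω, MeasurableSet A →
      MeasureTheory.Integrable (A.indicator fun _ => (1 : ℝ)) ν := fun A hA =>
    (MeasureTheory.integrable_const 1).indicator hA
  have hU : MeasurableSet (⋃ i ∈ S, E i) := Finset.measurableSet_biUnion S hE
  have hpt : ∀ x, 2 * a * ∑ i ∈ S, (E i).indicator (fun _ => (1 : ℝ)) x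
      - a ^ 2 * ∑ i ∈ S, ∑ j ∈ S, (E i ∩ E j).indicator (fun _ => (1 : ℝ)) x ≤
      (⋃ i ∈ S, E i).indicator (fun _ => (1 : ℝ)) x := by
    intro x
    have hsq : ∑ i ∈ S, ∑ j ∈ S, (E i ∩ E j).indicator (fun _ => (1 : ℝ)) x
        = (∑ i ∈ S, (E i).indicator (fun _ => (1 : ℝ)) x) ^ 2 := by
      rw [sq, Finset.sum_mul_sum]
      refine Finset.sum_congr rfl fun i _ => Finset.sum_congr rfl fun j _ => ?_
      by_cases hi : x ∈ E i <;> by_cases hj : x ∈ E j <;> simp [hi, hj]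
    rw [hsq]
    by_cases hx : x ∈ ⋃ i ∈ S, E i
    · rw [Set.indicator_of_mem hx]
      nlinarith [sq_nonneg (1 - a * ∑ i ∈ S, (E i).indicator (fun _ => (1 : ℝ)) x)]
    · have h0 : ∑ i ∈ S, (E i).indicator (fun _ => (1 : ℝ)) x = 0 :=
        Finset.sum_eq_zero fun i hi => Set.indicator_of_notMem
          (fun hxi => hx (Set.mem_biUnion hi hxi)) _
      rw [Set.indicator_of_notMem hx, h0]
      simp
  have hi₁ : MeasureTheory.Integrable
      (fun x => ∑ i ∈ S, (E i).indicator (fun _ => (1 : ℝ)) x) ν :=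
    MeasureTheory.integrable_finsetSum S fun i hi => hone _ (hE i hi)
  have hi₂ : MeasureTheory.Integrable
      (fun x => ∑ i ∈ S, ∑ j ∈ S, (E i ∩ E j).indicator (fun _ => (1 : ℝ)) x) ν :=
    MeasureTheory.integrable_finsetSum S fun i hi => MeasureTheory.integrable_finsetSum S
      fun j hj => hone _ ((hE i hi).inter (hE j hj))
  have hval : ∀ A : Set Ω, MeasurableSet A →
      ∫ x, A.indicator (fun _ => (1 : ℝ)) x ∂ν = ν.real A := fun A hA => by
    rw [MeasureTheory.integral_indicator_const (1 : ℝ) hA, smul_eq_mul, mul_one]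
  have := MeasureTheory.integral_mono ((hi₁.const_mul (2 * a)).sub (hi₂.const_mul (a ^ 2)))
    (hone _ hU) hpt
  simp only [Pi.sub_apply] at this
  rw [hval _ hU, MeasureTheory.integral_sub (hi₁.const_mul _) (hi₂.const_mul _),
    MeasureTheory.integral_const_mul, MeasureTheory.integral_const_mul,
    MeasureTheory.integral_finsetSum S fun i hi => hone _ (hE i hi),
    MeasureTheory.integral_finsetSum S fun i hi => MeasureTheory.integrable_finsetSum S
      fun j hj => hone _ ((hE i hi).inter (hE j hj)),
    Finset.sum_congr rfl fun i hi => hval _ (hE i hi),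
    Finset.sum_congr rfl fun i hi => (MeasureTheory.integral_finsetSum S
      fun j hj => hone _ ((hE i hi).inter (hE j hj))).trans
        (Finset.sum_congr rfl fun j hj => hval _ ((hE i hi).inter (hE j hj)))] at this
  exact this

lemma BadlyApprox.le_abs_combination {α δ : ℝ} (h : BadlyApprox α δ) {q q' m : ℕ}
    (hm : 8 ≤ δ * m) (hq0' : 0 < q') (hq : nint (α * q) * 2 ^ (21 * m) ≤ 2)
    (hq' : nint (α * q') * 2 ^ (21 * m) ≤ 2) (hco : IsCoprime (q : ℤ) (round (α * q)))
    (hco' : IsCoprime (q' : ℤ) (round (α * q'))) (hne : q ≠ q') {n n' : ℤ}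
    (hn : |(n : ℝ)| ≤ 2 ^ (4 * m)) (hn' : |(n' : ℝ)| ≤ 2 ^ (4 * m)) (hnn : n ≠ 0 ∨ n' ≠ 0) :
    (2 : ℝ) ^ (9 * m) ≤ |(n : ℝ) * q + n' * q'| := by
  have hm0 : m ≠ 0 := by
    rintro rfl
    norm_num at hm
  have hδ : 8 ≤ δ * 2 ^ m := by
    have h₁ : (m : ℝ) ≤ 2 ^ m := by exact_mod_cast (Nat.lt_two_pow_self (n := m)).le
    have hδ0 : 0 < δ := by
      by_contra hcon
      have : (0 : ℝ) ≤ m := by positivity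
      nlinarith
    nlinarith
  by_contra! hlt
  set w : ℤ := n * q + n' * q' with hw
  set z : ℤ := n * round (α * q) + n' * round (α * q') with hz
  have hwr : (n : ℝ) * q + n' * q' = w := by rw [hw]; push_cast; ring
  rw [hwr] at hlt
  have hwz : |α * w - z| * 2 ^ (17 * m) ≤ 4 := by
    have e : α * w - z = n * (α * q - round (α * q)) + n' * (α * q' - round (α * q')) := by
      rw [hw, hz]; push_cast; ring
    have h₁ : |α * w - z| ≤ 2 ^ (4 * m) * nint (α * q) + 2 ^ (4 * m) * nint (α * q') := by
      rw [e]
      refine (abs_add_le _ _).trans ?_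
      rw [abs_mul, abs_mul]
      exact add_le_add (mul_le_mul_of_nonneg_right hn (abs_nonneg _))
        (mul_le_mul_of_nonneg_right hn' (abs_nonneg _))
    have h₂ : (2 : ℝ) ^ (21 * m) = 2 ^ (4 * m) * 2 ^ (17 * m) := by
      rw [← pow_add]; congr 1; ring
    rw [h₂] at hq hq'
    nlinarith [mul_le_mul_of_nonneg_right h₁ (by positivity : (0 : ℝ) ≤ 2 ^ (17 * m))]
  by_cases hw0 : w = 0
  · have hz0 : z = 0 := by
      rw [hw0, Int.cast_zero, mul_zero, zero_sub, abs_neg] at hwz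
      have h₁ : (2 : ℝ) ^ 17 ≤ 2 ^ (17 * m) := pow_le_pow_right₀ (by norm_num) (by omega)
      have h₂ : |(z : ℝ)| < 1 := by nlinarith [abs_nonneg (z : ℝ)]
      exact Int.abs_lt_one_iff.mp (by exact_mod_cast h₂)
    have hn0 : n ≠ 0 := by
      rintro rfl
      rcases hnn with h1 | h1
      · exact h1 rfl
      · rw [hw, zero_mul, zero_add, mul_eq_zero] at hw0
        rcases hw0 with h2 | h2
        · exact h1 h2
        · omega
    have hcross : (q : ℤ) * round (α * q') = round (α * q) * q' := by
      have : n * ((q : ℤ) * round (α * q')) = n * (round (α * q) * q') := by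
        linear_combination round (α * q') * (hw0 : n * (q : ℤ) + n' * q' = 0)
          - (q' : ℤ) * (hz0 : n * round (α * q) + n' * round (α * q') = 0)
      exact mul_left_cancel₀ hn0 this
    have hd₁ : (q : ℤ) ∣ q' := hco.dvd_of_dvd_mul_left ⟨_, hcross.symm⟩
    have hd₂ : (q' : ℤ) ∣ q := hco'.dvd_of_dvd_mul_right ⟨round (α * q), by
      rw [hcross, mul_comm]⟩
    exact hne (Nat.dvd_antisymm (by exact_mod_cast hd₁) (by exact_mod_cast hd₂))
  · have h₁ := h.le_abs_mul hw0 z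
    have h₂ : (2 : ℝ) ^ (17 * m) = 2 ^ (9 * m) * (2 ^ m * 2 ^ (7 * m)) := by
      rw [← pow_add, ← pow_add]; congr 1; ring
    have h₃ : |(w : ℝ)| * |α * w - z| * (2 ^ m * 2 ^ (7 * m)) ≤ 4 := by
      refine le_trans ?_ hwz
      rw [h₂]
      calc |(w : ℝ)| * |α * w - z| * (2 ^ m * 2 ^ (7 * m))
          ≤ 2 ^ (9 * m) * |α * w - z| * (2 ^ m * 2 ^ (7 * m)) := by gcongr
        _ = _ := by ring
    have h₄ : (1 : ℝ) ≤ 2 ^ (7 * m) := one_le_pow₀ (by norm_num)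
    have h₅ : δ * (2 ^ m * 2 ^ (7 * m)) ≤ 4 :=
      (mul_le_mul_of_nonneg_right h₁ (by positivity)).trans h₃
    nlinarith

lemma IsGoodFamily.le_volume_inter {α δ : ℝ} (h : BadlyApprox α δ) (hδ : 0 < δ) {B m : ℕ}
    {S : Finset ℕ} (hS : IsGoodFamily α (1 / 24) B m S) (hm : 8 ≤ δ * m) {u l : ℝ}
    (hl : 1 ≤ l * 2 ^ m) :
    1 / 8960 * l ≤ MeasureTheory.volume.real (Set.Ico u (u + l) ∩
      ⋃ q ∈ S, nearSet q (1 / (q * (m : ℝ) ^ 2 * nint (α * q)))) := by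
  have hl0 : 0 < l := by
    by_contra hcon
    have : (0 : ℝ) < 2 ^ m := by positivity
    nlinarith
  have hm0 : 0 < m := by
    rcases Nat.eq_zero_or_pos m with rfl | h0
    · norm_num at hm
    · exact h0
  have hmr : (1 : ℝ) ≤ m := by exact_mod_cast hm0
  set ρ : ℕ → ℝ := fun q => 1 / (q * (m : ℝ) ^ 2 * nint (α * q)) with hρ
  have hqpos : ∀ q ∈ S, 0 < q := fun q hq =>
    lt_of_lt_of_le (by positivity) (hS.1 q hq).1
  have hprod : ∀ q ∈ S, 0 < (q : ℝ) * nint (α * q) := fun q hq => h.mul_nint_pos hδ (hqpos q hq)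
  have hρpos : ∀ q ∈ S, 0 < ρ q := fun q hq => by
    have := hprod q hq
    have e : (q : ℝ) * (m : ℝ) ^ 2 * nint (α * q) = (m : ℝ) ^ 2 * (q * nint (α * q)) := by ring
    simp only [hρ]
    rw [e]
    positivity
  have hρinv : ∀ q ∈ S, ρ q * ((m : ℝ) ^ 2 * (q * nint (α * q))) = 1 := fun q hq => by
    have h₁ := hprod q hq
    simp only [hρ]
    rw [show (q : ℝ) * (m : ℝ) ^ 2 * nint (α * q) = (m : ℝ) ^ 2 * (q * nint (α * q)) by ring]
    exact one_div_mul_cancel (by positivity)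
  have hρ8 : ∀ q ∈ S, ρ q ≤ 1 / 8 := fun q hq => by
    have h₁ := hρinv q hq
    have h₂ := h q (hqpos q hq)
    have h₃ : 8 ≤ (m : ℝ) ^ 2 * (q * nint (α * q)) := by
      calc (8 : ℝ) ≤ δ * m := hm
        _ ≤ (q * nint (α * q)) * (m * m) :=
            mul_le_mul h₂ (by nlinarith) (by positivity) (hprod q hq).le
        _ = _ := by ring
    nlinarith [hρpos q hq]
  have hql : ∀ q ∈ S, 4 ≤ q * l := fun q hq => by
    have h₁ : (2 : ℝ) ^ (20 * m) ≤ q := by exact_mod_cast (hS.1 q hq).1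
    have h₂ : (2 : ℝ) ^ (20 * m) = 2 ^ (19 * m) * 2 ^ m := by rw [← pow_add]; congr 1; ring
    have h₃ : (2 : ℝ) ^ 2 ≤ 2 ^ (19 * m) := pow_le_pow_right₀ (by norm_num) (by omega)
    calc (4 : ℝ) ≤ 2 ^ (19 * m) * 1 := by linarith
      _ ≤ 2 ^ (19 * m) * (l * 2 ^ m) := by gcongr
      _ = 2 ^ (20 * m) * l := by rw [h₂]; ring
      _ ≤ q * l := by gcongr
  set N : ℕ → ℕ := fun q => ⌊1 / (8 * ρ q)⌋₊ with hN
  have hone : ∀ q ∈ S, 1 ≤ 1 / (8 * ρ q) := fun q hq => by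
    have := hρpos q hq
    rw [le_div_iff₀ (by positivity)]
    linarith [hρ8 q hq]
  have hN1 : ∀ q ∈ S, 0 < N q := fun q hq => Nat.floor_pos.mpr (hone q hq)
  have hNle : ∀ q ∈ S, (N q : ℝ) ≤ 1 / (8 * ρ q) := fun q hq =>
    Nat.floor_le (zero_le_one.trans (hone q hq))
  have hNge : ∀ q ∈ S, 1 / (N q : ℝ) ≤ 16 * ρ q := fun q hq => by
    have h₁ : 1 / (8 * ρ q) < N q + 1 := Nat.lt_floor_add_one _
    have h₂ : (1 : ℝ) ≤ N q := by exact_mod_cast hN1 q hq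
    have h₃ := hρpos q hq
    rw [div_lt_iff₀ (by positivity)] at h₁
    rw [div_le_iff₀ (by positivity)]
    nlinarith
  have hNpow : ∀ q ∈ S, (N q : ℝ) ≤ 2 ^ (4 * m) := fun q hq => by
    refine (hNle q hq).trans ?_
    have h₀ := hρpos q hq
    have h₁ := hρinv q hq
    have h₂ := (hS.1 q hq).2.2.1
    have h₃ : (m : ℝ) ≤ 2 ^ m := by exact_mod_cast (Nat.lt_two_pow_self (n := m)).le
    have h₄ : 1 / (8 * ρ q) = (m : ℝ) ^ 2 * (q * nint (α * q)) / 8 := by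
      rw [div_eq_div_iff (by positivity) (by norm_num)]
      linarith
    have h₅ : (2 : ℝ) ^ (4 * m) = (2 ^ m) ^ 2 * 4 ^ m := by
      rw [← pow_mul, show (4 : ℝ) = 2 ^ 2 by norm_num, ← pow_mul, ← pow_add]; congr 1; ring
    rw [h₄, h₅]
    have h₆ : (m : ℝ) ^ 2 * (q * nint (α * q)) ≤ (2 ^ m) ^ 2 * (6 * 4 ^ m) := by
      have := (hprod q hq).le
      gcongr
    have h₇ : (0 : ℝ) ≤ (2 ^ m) ^ 2 * 4 ^ m := by positivity
    linarith
  have hpair : ∀ q ∈ S, ∀ q' ∈ S, q ≠ q' → MeasureTheory.volume.real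
      (Set.Ico u (u + l) ∩ (nearSet q (ρ q) ∩ nearSet q' (ρ q'))) ≤ 2048 * l * (ρ q * ρ q') := by
    intro q hq q' hq' hne
    have hNq : (0 : ℝ) < N q := by exact_mod_cast hN1 q hq
    have hNq' : (0 : ℝ) < N q' := by exact_mod_cast hN1 q' hq'
    have hmono : ∀ q ∈ S, nearSet q (ρ q) ⊆ nearSet q (1 / (8 * N q)) := fun q hq x hx => by
      refine le_trans (show nint (x * q) ≤ ρ q from hx) ?_
      have h₁ := hNle q hq
      have h₂ := hρpos q hq
      have h₃ : (0 : ℝ) < N q := by exact_mod_cast hN1 q hq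
      rw [le_div_iff₀ (by positivity)] at h₁ ⊢
      linarith
    have hfin : MeasureTheory.volume (Set.Ico u (u + l) ∩
        (nearSet q (1 / (8 * N q)) ∩ nearSet q' (1 / (8 * N q')))) ≠ ⊤ :=
      ne_top_of_le_ne_top (by simp) (MeasureTheory.measure_mono Set.inter_subset_left)
    refine (MeasureTheory.measureReal_mono (Set.inter_subset_inter_right _
      (Set.inter_subset_inter (hmono q hq) (hmono q' hq'))) hfin).trans ?_
    refine (volume_inter_nearSet_inter_nearSet_le hl0 (hN1 q hq) (hN1 q' hq') ?_).trans ?_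
    · intro n n' hn hn' hnn
      obtain ⟨-, -, -, h₁, h₂⟩ := hS.1 q hq
      obtain ⟨-, -, -, h₁', h₂'⟩ := hS.1 q' hq'
      refine le_trans ?_ (h.le_abs_combination hm (hqpos q' hq') h₁ h₁' h₂ h₂' hne
        (le_trans ?_ (hNpow q hq)) (le_trans ?_ (hNpow q' hq')) hnn)
      · rw [div_le_iff₀ hl0]
        have e : (2 : ℝ) ^ (9 * m) = 2 ^ (4 * m) * 2 ^ (4 * m) * 2 ^ m := by
          rw [← pow_add, ← pow_add]; congr 1; ring
        calc (N q : ℝ) * N q' ≤ 2 ^ (4 * m) * 2 ^ (4 * m) * 1 := by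
              rw [mul_one]; exact mul_le_mul (hNpow q hq) (hNpow q' hq') hNq'.le (by positivity)
          _ ≤ 2 ^ (4 * m) * 2 ^ (4 * m) * (l * 2 ^ m) := by gcongr
          _ = _ := by rw [e]; ring
      · exact_mod_cast hn.le
      · exact_mod_cast hn'.le
    · calc 8 * l / (N q * N q') = 8 * l * (1 / N q * (1 / N q')) := by field_simp
        _ ≤ 8 * l * (16 * ρ q * (16 * ρ q')) := by
            have := hρpos q hq
            exact mul_le_mul_of_nonneg_left (mul_le_mul (hNge q hq) (hNge q' hq')
              (by positivity) (by positivity)) (by positivity)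
        _ = _ := by ring
  set P := ∑ q ∈ S, ρ q with hP
  have hPge : 1 / 24 ≤ P := by
    have h₁ : P = 1 / (m : ℝ) ^ 2 * ∑ q ∈ S, 1 / ((q : ℝ) * nint (α * q)) := by
      rw [hP, Finset.mul_sum]
      refine Finset.sum_congr rfl fun q _ => ?_
      simp only [hρ]
      rw [one_div_mul_one_div]
      congr 1
      ring
    have h₂ := hS.2
    rw [h₁, one_div_mul_eq_div, le_div_iff₀ (by positivity)]
    exact h₂
  have hν : ∀ A : Set ℝ, MeasurableSet A →
      (MeasureTheory.volume.restrict (Set.Ico u (u + l))).real A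
        = MeasureTheory.volume.real (Set.Ico u (u + l) ∩ A) := fun A hA => by
    rw [MeasureTheory.measureReal_restrict_apply hA, Set.inter_comm]
  have : MeasureTheory.IsFiniteMeasure (MeasureTheory.volume.restrict (Set.Ico u (u + l))) :=
    ⟨by simp⟩
  set a : ℝ := 1 / (2 * (8 + 2048 * P)) with ha
  have ha0 : 0 < a := by positivity
  have hmain := sub_sum_measure_inter_le_measure_biUnion
    (MeasureTheory.volume.restrict (Set.Ico u (u + l))) S
    (E := fun q => nearSet q (ρ q)) (fun q _ => measurableSet_nearSet _ _) a
  rw [hν _ (Finset.measurableSet_biUnion S fun q _ => measurableSet_nearSet _ _)] at hmain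
  refine le_trans ?_ hmain
  have hfirst : P * l / 2 ≤ ∑ q ∈ S,
      (MeasureTheory.volume.restrict (Set.Ico u (u + l))).real (nearSet q (ρ q)) := by
    rw [hP, Finset.sum_mul, Finset.sum_div]
    refine Finset.sum_le_sum fun q hq => ?_
    rw [hν _ (measurableSet_nearSet _ _)]
    exact le_volume_inter_nearSet (hρpos q hq).le (by linarith [hρ8 q hq]) (hql q hq) hl0
  have hsecond : ∑ q ∈ S, ∑ q' ∈ S, (MeasureTheory.volume.restrict (Set.Ico u (u + l))).real
      (nearSet q (ρ q) ∩ nearSet q' (ρ q')) ≤ l * P * (8 + 2048 * P) := by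
    calc _ ≤ ∑ q ∈ S, ∑ q' ∈ S, ((if q = q' then 8 * ρ q * l else 0)
          + 2048 * l * (ρ q * ρ q')) := by
          refine Finset.sum_le_sum fun q hq => Finset.sum_le_sum fun q' hq' => ?_
          rw [hν _ ((measurableSet_nearSet _ _).inter (measurableSet_nearSet _ _))]
          by_cases hqq : q = q'
          · subst hqq
            rw [if_pos rfl, Set.inter_self]
            have h₁ := volume_inter_nearSet_le (q := q) (u := u) (hρpos q hq).le
              (by linarith [hql q hq]) hl0
            have h₂ := hρpos q hq
            have h₃ : 0 ≤ 2048 * l * (ρ q * ρ q) := by positivity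
            linarith
          · rw [if_neg hqq, zero_add]
            exact hpair q hq q' hq' hqq
      _ = ∑ q ∈ S, (8 * ρ q * l + 2048 * l * (ρ q * P)) := by
          refine Finset.sum_congr rfl fun q hq => ?_
          rw [Finset.sum_add_distrib, Finset.sum_ite_eq, if_pos hq, ← Finset.mul_sum,
            ← Finset.mul_sum]
      _ = l * P * (8 + 2048 * P) := by
          rw [Finset.sum_add_distrib, ← Finset.mul_sum, ← Finset.sum_mul, ← Finset.sum_mul,
            ← Finset.mul_sum]
          ring
  have hP0 : 0 < P := by linarith
  have e₁ : a * (8 + 2048 * P) = 1 / 2 := by rw [ha]; field_simp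
  have e₂ : 1 / 8960 ≤ a * P / 2 := by
    rw [ha, div_mul_eq_mul_div, one_mul, div_div, div_le_div_iff₀ (by norm_num) (by positivity)]
    nlinarith
  calc 1 / 8960 * l ≤ a * P / 2 * l := by gcongr
    _ = 2 * a * (P * l / 2) - a * (a * (8 + 2048 * P)) * (l * P) := by rw [e₁]; ring
    _ = 2 * a * (P * l / 2) - a ^ 2 * (l * P * (8 + 2048 * P)) := by ring
    _ ≤ _ := by gcongr

/-! ### Unions of dyadic cells -/

/-- `A` is a union of the dyadic intervals `[z / 2 ^ L, (z + 1) / 2 ^ L)`. -/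
def IsCellSet (L : ℕ) (A : Set ℝ) : Prop :=
  ∀ x y : ℝ, ⌊x * 2 ^ L⌋ = ⌊y * 2 ^ L⌋ → x ∈ A → y ∈ A

/-- The union of the dyadic intervals of level `L` that meet `W`. -/
def cellHull (L : ℕ) (W : Set ℝ) : Set ℝ := {x | ∃ y ∈ W, ⌊y * 2 ^ L⌋ = ⌊x * 2 ^ L⌋}

lemma subset_cellHull (L : ℕ) (W : Set ℝ) : W ⊆ cellHull L W := fun x hx => ⟨x, hx, rfl⟩

lemma isCellSet_cellHull (L : ℕ) (W : Set ℝ) : IsCellSet L (cellHull L W) := by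
  rintro x y hxy ⟨z, hz, hzx⟩
  exact ⟨z, hz, hzx.trans hxy⟩

lemma abs_sub_mul_le_one_of_floor_eq {x y : ℝ} {L : ℕ} (h : ⌊x * 2 ^ L⌋ = ⌊y * 2 ^ L⌋) :
    |x - y| * 2 ^ L ≤ 1 := by
  have := Int.abs_sub_lt_one_of_floor_eq_floor h
  rw [← sub_mul, abs_mul, abs_of_pos (by positivity : (0 : ℝ) < 2 ^ L)] at this
  exact this.le

namespace IsCellSet

variable {L L' : ℕ} {A A' W : Set ℝ}

lemma inter (hA : IsCellSet L A) (hA' : IsCellSet L A') : IsCellSet L (A ∩ A') :=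
  fun x y hxy hx => ⟨hA x y hxy hx.1, hA' x y hxy hx.2⟩

lemma diff (hA : IsCellSet L A) (hA' : IsCellSet L A') : IsCellSet L (A \ A') :=
  fun x y hxy hx => ⟨hA x y hxy hx.1, fun hy => hx.2 (hA' y x hxy.symm hy)⟩

lemma mono (hA : IsCellSet L A) (hL : L ≤ L') : IsCellSet L' A := by
  intro x y hxy hx
  obtain ⟨k, rfl⟩ := Nat.exists_eq_add_of_le hL
  refine hA x y ?_ hx
  have key : ∀ x : ℝ, ⌊x * 2 ^ L⌋ = ⌊x * 2 ^ (L + k)⌋ / ((2 ^ k : ℕ) : ℤ) := fun x => by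
    rw [← Int.floor_div_natCast]
    congr 1
    rw [pow_add]
    push_cast
    field_simp
  rw [key, key, hxy]

lemma measurableSet (hA : IsCellSet L A) : MeasurableSet A := by
  have : A = (fun x : ℝ => ⌊x * 2 ^ L⌋) ⁻¹' ((fun x : ℝ => ⌊x * 2 ^ L⌋) '' A) := by
    refine Set.Subset.antisymm (Set.subset_preimage_image _ _) ?_
    rintro x ⟨y, hy, hyx⟩
    exact hA y x hyx hy
  rw [this]
  exact (Int.measurable_floor.comp (measurable_id.mul_const _)) trivial

lemma volume_inter_le (hA : IsCellSet L A) (hA1 : A ⊆ Set.Ico 0 1) {η : ℝ}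
    (hW : ∀ u : ℝ, MeasureTheory.volume.real (Set.Ico u (u + (2 ^ L)⁻¹) ∩ W) ≤ η * (2 ^ L)⁻¹) :
    MeasureTheory.volume.real (A ∩ W) ≤ η * MeasureTheory.volume.real A := by
  classical
  have hpos : (0 : ℝ) < 2 ^ L := by positivity
  set I : ℤ → Set ℝ := fun z => Set.Ico ((z : ℝ) / 2 ^ L) ((z : ℝ) / 2 ^ L + (2 ^ L)⁻¹) with hI
  have hmemI : ∀ (z : ℤ) (x : ℝ), x ∈ I z ↔ ⌊x * 2 ^ L⌋ = z := by
    intro z x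
    simp only [hI]
    rw [Set.mem_Ico, Int.floor_eq_iff, div_le_iff₀ hpos, inv_eq_one_div, ← add_div,
      lt_div_iff₀ hpos]
  set J := (Finset.Ico (0 : ℤ) (2 ^ L)).filter fun z : ℤ => ((z : ℝ) / 2 ^ L) ∈ A with hJ
  have hAeq : A = ⋃ z ∈ J, I z := by
    ext x
    simp only [Set.mem_iUnion, exists_prop, hmemI]
    constructor
    · intro hx
      refine ⟨_, ?_, rfl⟩
      have hx1 := hA1 hx
      rw [hJ, Finset.mem_filter, Finset.mem_Ico, Int.floor_nonneg, Int.floor_lt]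
      refine ⟨⟨mul_nonneg hx1.1 hpos.le, ?_⟩, hA x _ ?_ hx⟩
      · push_cast
        nlinarith [hx1.2]
      · rw [div_mul_cancel₀ _ hpos.ne', Int.floor_intCast]
    · rintro ⟨z, hz, hxz⟩
      rw [hJ, Finset.mem_filter] at hz
      refine hA _ x ?_ hz.2
      rw [div_mul_cancel₀ _ hpos.ne', Int.floor_intCast, hxz]
  have hdisj : Set.PairwiseDisjoint (J : Set ℤ) I := by
    intro z _ z' _ hne
    refine Set.disjoint_left.mpr fun x hx hx' => hne ?_
    rw [← (hmemI z x).mp hx, (hmemI z' x).mp hx']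
  have hvol : MeasureTheory.volume.real A = ∑ z ∈ J, ((2 : ℝ) ^ L)⁻¹ := by
    rw [hAeq, MeasureTheory.measureReal_biUnion_finset hdisj (fun _ _ => measurableSet_Ico)
      (by simp [hI])]
    refine Finset.sum_congr rfl fun z _ => ?_
    simp only [hI]
    rw [Real.volume_real_Ico_of_le (by simp)]
    ring
  rw [hvol, Finset.mul_sum, hAeq, Set.iUnion₂_inter]
  exact (MeasureTheory.measureReal_biUnion_finset_le _ _).trans
    (Finset.sum_le_sum fun z _ => hW _)

end IsCellSet

/-! ### The nested construction -/

/-- The factor multiplying `nint (x * q)` at scale `t`. -/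
noncomputable def weight (α : ℝ) (t q : ℕ) : ℝ := (q : ℝ) * (t : ℝ) ^ 2 * nint (α * q)

lemma weight_nonneg (α : ℝ) (t q : ℕ) : 0 ≤ weight α t q :=
  mul_nonneg (by positivity) (nint_nonneg _)

lemma BadlyApprox.weight_pos {α δ : ℝ} (h : BadlyApprox α δ) (hδ : 0 < δ) {t q : ℕ} (ht : 0 < t)
    (hq : 0 < q) : 0 < weight α t q :=
  mul_pos (by positivity) (h.nint_pos hδ hq)

lemma nint_le_one (t : ℝ) : nint t ≤ 1 :=
  (abs_sub_round t).trans (by norm_num)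

lemma weight_mul_nint_le_add {α κ x y : ℝ} {T t q : ℕ} (hq : q ≤ 2 ^ T) (hT : 3 * t ≤ T)
    (hκ : 1 ≤ κ * 2 ^ t) (hxy : ⌊x * 2 ^ (3 * T)⌋ = ⌊y * 2 ^ (3 * T)⌋) :
    weight α t q * nint (y * q) ≤ weight α t q * nint (x * q) + κ := by
  have hd := abs_sub_mul_le_one_of_floor_eq hxy
  have hqR : (q : ℝ) ≤ 2 ^ T := by exact_mod_cast hq
  have htR : (t : ℝ) ≤ 2 ^ t := by exact_mod_cast Nat.lt_two_pow_self.le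
  have hTR : ((2 : ℝ) ^ t) ^ 3 ≤ 2 ^ T := by
    rw [← pow_mul]
    exact pow_le_pow_right₀ (by norm_num) (by omega)
  have hnear := nint_le_add_abs_sub (x * q) (y * q)
  rw [← sub_mul, abs_mul, abs_of_nonneg (Nat.cast_nonneg q : (0 : ℝ) ≤ q)] at hnear
  have hw : weight α t q ≤ 2 ^ T * (2 ^ t) ^ 2 :=
    calc weight α t q ≤ (q : ℝ) * (t : ℝ) ^ 2 * 1 :=
          mul_le_mul_of_nonneg_left (nint_le_one _) (by positivity)
      _ ≤ 2 ^ T * (2 ^ t) ^ 2 := by rw [mul_one]; gcongr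
  have herr : weight α t q * (|x - y| * q) ≤ κ := by
    have h₁ : weight α t q * (|x - y| * q) ≤ 2 ^ T * (2 ^ t) ^ 2 * (|x - y| * 2 ^ T) := by
      gcongr
    have h₂ : (2 : ℝ) ^ T * (2 ^ t) ^ 2 * (|x - y| * 2 ^ T) * 2 ^ t ≤ 1 :=
      calc (2 : ℝ) ^ T * (2 ^ t) ^ 2 * (|x - y| * 2 ^ T) * 2 ^ t
          = |x - y| * (2 ^ T * 2 ^ T * (2 ^ t) ^ 3) := by ring
        _ ≤ |x - y| * (2 ^ T * 2 ^ T * 2 ^ T) := by gcongr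
        _ = |x - y| * 2 ^ (3 * T) := by ring
        _ ≤ 1 := hd
    refine h₁.trans (le_of_mul_le_mul_right (h₂.trans hκ) (by positivity))
  nlinarith [mul_le_mul_of_nonneg_left hnear (weight_nonneg α t q)]

/-- The points for which some `q ∈ Q` makes the weighted distance at scale `t` at most `κ`. -/
noncomputable def nearUnion (α : ℝ) (t : ℕ) (Q : Finset ℕ) (κ : ℝ) : Set ℝ :=
  {x | ∃ q ∈ Q, weight α t q * nint (x * q) ≤ κ}

lemma cellHull_nearUnion_subset {α κ : ℝ} {T t : ℕ} {Q : Finset ℕ} (hQ : ∀ q ∈ Q, q ≤ 2 ^ T)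
    (hT : 3 * t ≤ T) (hκ : 1 ≤ κ * 2 ^ t) :
    cellHull (3 * T) (nearUnion α t Q κ) ⊆ nearUnion α t Q (2 * κ) := by
  rintro y ⟨x, ⟨q, hq, hx⟩, hxy⟩
  refine ⟨q, hq, ?_⟩
  have := weight_mul_nint_le_add (α := α) (hQ q hq) hT hκ hxy
  linarith

lemma nearUnion_eq_biUnion {α δ κ : ℝ} (h : BadlyApprox α δ) (hδ : 0 < δ) {t : ℕ} (ht : 0 < t)
    {Q : Finset ℕ} (hQ : ∀ q ∈ Q, 0 < q) :
    nearUnion α t Q κ = ⋃ q ∈ Q, nearSet q (κ / weight α t q) := by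
  ext x
  simp only [nearUnion, nearSet, Set.mem_ofPred_eq, Set.mem_iUnion, exists_prop]
  refine exists_congr fun q => and_congr_right fun hq => ?_
  rw [le_div_iff₀ (h.weight_pos hδ ht (hQ q hq)), mul_comm]

lemma volume_inter_cellHull_le {α δ κ C η : ℝ} (h : BadlyApprox α δ) (hδ : 0 < δ) (hκ0 : 0 < κ)
    (hC : ∀ T : ℕ, ∑ q ∈ Finset.Ico (1 : ℕ) (2 ^ T), 1 / ((q : ℝ) * nint (α * q)) ≤ C * (T : ℝ) ^ 2)
    {L a T t B : ℕ} (ht : 0 < t) (hL : L ≤ a) (hT : 3 * t ≤ T) (hTB : T ≤ t * B)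
    (hκ : 1 ≤ κ * 2 ^ t) (hη : 16 * κ * C * B ^ 2 ≤ η) (hC0 : 0 < C) (u : ℝ) :
    MeasureTheory.volume.real (Set.Ico u (u + (2 ^ L)⁻¹) ∩
      cellHull (3 * T) (nearUnion α t (Finset.Ico (2 ^ a) (2 ^ T)) κ)) ≤ η * (2 ^ L)⁻¹ := by
  have hpos : ∀ q ∈ Finset.Ico (2 ^ a) (2 ^ T), 0 < q := fun q hq =>
    (Nat.two_pow_pos a).trans_le (Finset.mem_Ico.mp hq).1
  have hsub := cellHull_nearUnion_subset (α := α) (Q := Finset.Ico (2 ^ a) (2 ^ T))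
    (fun q hq => (Finset.mem_Ico.mp hq).2.le) hT hκ
  rw [nearUnion_eq_biUnion (κ := 2 * κ) h hδ ht hpos] at hsub
  set l : ℝ := (2 ^ L)⁻¹ with hl
  have hl0 : 0 < l := by positivity
  have htR : (0 : ℝ) < t := by exact_mod_cast ht
  calc _ ≤ MeasureTheory.volume.real (⋃ q ∈ Finset.Ico (2 ^ a) (2 ^ T),
          Set.Ico u (u + l) ∩ nearSet q (2 * κ / weight α t q)) := by
        rw [← Set.inter_iUnion₂]
        exact MeasureTheory.measureReal_mono (Set.inter_subset_inter_right _ hsub)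
          ((MeasureTheory.measure_mono Set.inter_subset_left).trans_lt measure_Ico_lt_top).ne
    _ ≤ ∑ q ∈ Finset.Ico (2 ^ a) (2 ^ T), MeasureTheory.volume.real
          (Set.Ico u (u + l) ∩ nearSet q (2 * κ / weight α t q)) :=
        MeasureTheory.measureReal_biUnion_finset_le _ _
    _ ≤ ∑ q ∈ Finset.Ico (2 ^ a) (2 ^ T), 8 * (2 * κ / weight α t q) * l := by
        refine Finset.sum_le_sum fun q hq => volume_inter_nearSet_le
          (div_nonneg (by positivity) (weight_nonneg _ _ _)) ?_ hl0
        have : (2 : ℝ) ^ L ≤ q := by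
          exact_mod_cast (Nat.pow_le_pow_right two_pos hL).trans (Finset.mem_Ico.mp hq).1
        rw [hl, ← div_eq_mul_inv]
        exact (one_le_div (by positivity)).mpr this
    _ = 16 * κ * l / t ^ 2 *
          ∑ q ∈ Finset.Ico ((2 : ℕ) ^ a) (2 ^ T), 1 / ((q : ℝ) * nint (α * q)) := by
        rw [Finset.mul_sum]
        refine Finset.sum_congr rfl fun q hq => ?_
        have h₁ := (h.nint_pos hδ (hpos q hq)).ne'
        have h₂ : (q : ℝ) ≠ 0 := by exact_mod_cast (hpos q hq).ne'
        rw [weight]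
        field_simp
        ring
    _ ≤ 16 * κ * l / t ^ 2 * (C * (T : ℝ) ^ 2) := by
        refine mul_le_mul_of_nonneg_left (le_trans ?_ (hC T)) (by positivity)
        refine Finset.sum_le_sum_of_subset_of_nonneg
          (Finset.Ico_subset_Ico_left Nat.one_le_two_pow) fun q hq _ => ?_
        exact one_div_nonneg.mpr (mul_nonneg (Nat.cast_nonneg _) (nint_nonneg _))
    _ ≤ 16 * κ * l / t ^ 2 * (C * ((t : ℝ) * B) ^ 2) := by
        have : (T : ℝ) ≤ (t : ℝ) * B := by exact_mod_cast hTB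
        gcongr
    _ = 16 * κ * C * B ^ 2 * l := by
        field_simp
    _ ≤ η * l := by gcongr

/-- Two nested unions of dyadic intervals: `X` is coarse, and `Y` is finer but fills most of `X`. -/
structure IsCellPair (B s : ℕ) (X Y : Set ℝ) : Prop where
  coarse : IsCellSet (3 * s) X
  fine : IsCellSet (3 * (s * B)) Y
  subset : Y ⊆ X
  subset_Ico : X ⊆ Set.Ico 0 1
  pos : 0 < MeasureTheory.volume.real X
  le : (1 - 1 / 17920) * MeasureTheory.volume.real X ≤ MeasureTheory.volume.real Y

lemma isCellPair_Ico (B s : ℕ) : IsCellPair B s (Set.Ico 0 1) (Set.Ico 0 1) := by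
  have hcell : ∀ L : ℕ, IsCellSet L (Set.Ico 0 1) := fun L => by
    refine IsCellSet.mono (L := 0) (fun x y hxy hx => ?_) (Nat.zero_le L)
    simp only [pow_zero, mul_one] at hxy
    rwa [← Int.floor_eq_zero_iff, ← hxy, Int.floor_eq_zero_iff]
  exact ⟨hcell _, hcell _, subset_rfl, subset_rfl, by simp, by norm_num⟩

lemma IsGoodFamily.pos {α c : ℝ} {B m : ℕ} {S : Finset ℕ} (hS : IsGoodFamily α c B m S) {q : ℕ}
    (hq : q ∈ S) : 0 < q :=
  (Nat.two_pow_pos _).trans_le (hS.1 q hq).1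

/-- The points that stay away from zero in the block of scale `t` but come close for some
`q ∈ S`. -/
def goodSet (α ε : ℝ) (B t : ℕ) (S : Finset ℕ) : Set ℝ :=
  {x | (∀ q ∈ Finset.Ico (2 ^ t) (2 ^ (t * B ^ 2)), ε ≤ weight α t q * nint (x * q)) ∧
    ∃ q ∈ S, weight α t q * nint (x * q) ≤ 2}

lemma isClosed_goodSet (α ε : ℝ) (B t : ℕ) (S : Finset ℕ) : IsClosed (goodSet α ε B t S) := by
  have hcont : ∀ q : ℕ, Continuous fun x : ℝ => weight α t q * nint (x * q) := fun q =>
    continuous_const.mul (continuous_nint.comp (continuous_id.mul continuous_const))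
  refine IsClosed.and ?_ ?_
  · simp only [Set.ofPred_forall]
    exact isClosed_biInter fun q _ => isClosed_le continuous_const (hcont q)
  · have : {x : ℝ | ∃ q ∈ S, weight α t q * nint (x * q) ≤ 2} =
        ⋃ q ∈ S, {x : ℝ | weight α t q * nint (x * q) ≤ 2} := by ext; simp
    rw [this]
    exact S.finite_toSet.isClosed_biUnion fun q _ => isClosed_le (hcont q) continuous_const

lemma IsCellPair.exists_next {α δ ε C : ℝ} {B s : ℕ} {S : Finset ℕ} {X Y : Set ℝ}
    (hXY : IsCellPair B s X Y) (h : BadlyApprox α δ) (hδ : 0 < δ) (hε : 0 < ε) (hC0 : 0 < C)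
    (hC : ∀ T : ℕ, ∑ q ∈ Finset.Ico (1 : ℕ) (2 ^ T), 1 / ((q : ℝ) * nint (α * q)) ≤ C * (T : ℝ) ^ 2)
    (hη : 16 * ε * C * B ^ 4 ≤ (1 / 8960) ^ 2 / 8) (hB : 3 ≤ B) (hs : 0 < s)
    (hS : IsGoodFamily α (1 / 24) B (s * B) S) (hm : 8 ≤ δ * ((s * B : ℕ) : ℝ))
    (hκ : 1 ≤ ε * 2 ^ (s * B)) :
    ∃ X' Y', IsCellPair B (s * B ^ 2) X' Y' ∧ Y' ⊆ Y ∧ Y' ⊆ goodSet α ε B (s * B) S := by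
  set t := s * B with ht
  have hst : s * B ^ 2 = t * B := by rw [ht]; ring
  rw [hst]
  have ht0 : 0 < t := Nat.mul_pos hs (by omega)
  have h3s : 3 * s ≤ t := by rw [ht, mul_comm]; exact Nat.mul_le_mul_left s hB
  have h3t : 3 * t ≤ t * B := by rw [mul_comm]; exact Nat.mul_le_mul_left t hB
  have htB : t * B ≤ t * B ^ 2 := Nat.mul_le_mul_left t (Nat.le_self_pow two_ne_zero B)
  have htBB : t * B * B = t * B ^ 2 := by ring
  set V₁ := cellHull (3 * (t * B)) (nearUnion α t (Finset.Ico (2 ^ t) (2 ^ (t * B))) ε) with hV₁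
  set V₂ := cellHull (3 * (t * B ^ 2))
    (nearUnion α t (Finset.Ico (2 ^ (t * B)) (2 ^ (t * B ^ 2))) ε) with hV₂
  set U := cellHull (3 * (t * B)) (nearUnion α t S 1) with hU
  have hη' : 16 * ε * C * ((B ^ 2 : ℕ) : ℝ) ^ 2 ≤ (1 / 8960) ^ 2 / 8 := by
    refine le_of_eq_of_le ?_ hη
    push_cast
    ring
  have hXV₁ : MeasureTheory.volume.real (X ∩ V₁) ≤
      (1 / 8960) ^ 2 / 8 * MeasureTheory.volume.real X :=
    hXY.coarse.volume_inter_le hXY.subset_Ico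
      (volume_inter_cellHull_le h hδ hε hC ht0 h3s h3t htB hκ hη' hC0)
  have hYV₂ : MeasureTheory.volume.real (Y ∩ V₂) ≤
      (1 / 8960) ^ 2 / 8 * MeasureTheory.volume.real Y :=
    hXY.fine.volume_inter_le (hXY.subset.trans hXY.subset_Ico)
      (volume_inter_cellHull_le h hδ hε hC ht0 h3t (h3t.trans htB) le_rfl hκ hη' hC0)
  have hUmeas : MeasurableSet U := (isCellSet_cellHull _ _).measurableSet
  have hXU : MeasureTheory.volume.real (X ∩ Uᶜ) ≤
      (1 - 1 / 8960) * MeasureTheory.volume.real X := by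
    refine hXY.coarse.volume_inter_le hXY.subset_Ico fun u => ?_
    set l : ℝ := (2 ^ (3 * s))⁻¹ with hl
    have hl0 : 0 < l := by positivity
    have hl1 : 1 ≤ l * 2 ^ t := by
      rw [hl, inv_mul_eq_div]
      exact (one_le_div (by positivity)).mpr (pow_le_pow_right₀ (by norm_num) h3s)
    have hlow := hS.le_volume_inter h hδ hm (u := u) hl1
    have heq := nearUnion_eq_biUnion (κ := 1) h hδ ht0 (Q := S) (fun q hq => hS.pos hq)
    simp only [weight] at heq
    rw [← heq] at hlow
    have hfin : MeasureTheory.volume (Set.Ico u (u + l)) ≠ ⊤ := measure_Ico_lt_top.ne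
    have hmono : MeasureTheory.volume.real (Set.Ico u (u + l) ∩ nearUnion α t S 1) ≤
        MeasureTheory.volume.real (Set.Ico u (u + l) ∩ U) :=
      MeasureTheory.measureReal_mono (Set.inter_subset_inter_right _ (subset_cellHull _ _))
        ((MeasureTheory.measure_mono Set.inter_subset_left).trans_lt measure_Ico_lt_top).ne
    have hsum := MeasureTheory.measureReal_inter_add_sdiff (s := Set.Ico u (u + l)) hUmeas hfin
    rw [Real.volume_real_Ico_of_le (by linarith), Set.sdiff_eq] at hsum
    linarith
  have hfin : ∀ A ⊆ Set.Ico (0 : ℝ) 1, MeasureTheory.volume A ≠ ⊤ := fun A hA =>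
    ((MeasureTheory.measure_mono hA).trans_lt measure_Ico_lt_top).ne
  set X' := (Y ∩ U) \ V₁ with hX'
  set Y' := X' \ V₂ with hY'
  have hX'Y : X' ⊆ Y := fun x hx => hx.1.1
  have hY1 := hXY.subset.trans hXY.subset_Ico
  have hYX : MeasureTheory.volume.real Y ≤ MeasureTheory.volume.real X :=
    MeasureTheory.measureReal_mono hXY.subset (hfin _ hXY.subset_Ico)
  have hYle : MeasureTheory.volume.real Y ≤ MeasureTheory.volume.real X' +
      (MeasureTheory.volume.real (X ∩ Uᶜ) + MeasureTheory.volume.real (X ∩ V₁)) := by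
    refine le_trans (MeasureTheory.measureReal_mono (s₂ := X' ∪ ((X ∩ Uᶜ) ∪ (X ∩ V₁))) ?_ ?_)
      ((MeasureTheory.measureReal_union_le _ _).trans
        (add_le_add_right (MeasureTheory.measureReal_union_le _ _) _))
    · intro x hx
      have hxX := hXY.subset hx
      by_cases hxU : x ∈ U
      · by_cases hxV : x ∈ V₁
        · exact Or.inr (Or.inr ⟨hxX, hxV⟩)
        · exact Or.inl ⟨⟨hx, hxU⟩, hxV⟩
      · exact Or.inr (Or.inl ⟨hxX, hxU⟩)
    · refine hfin _ (Set.union_subset (hX'Y.trans hY1) (Set.union_subset ?_ ?_)) <;>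
        exact Set.inter_subset_left.trans hXY.subset_Ico
  have hX'le : MeasureTheory.volume.real X' ≤
      MeasureTheory.volume.real Y' + MeasureTheory.volume.real (Y ∩ V₂) := by
    refine le_trans (MeasureTheory.measureReal_mono (s₂ := Y' ∪ (Y ∩ V₂)) ?_ ?_)
      (MeasureTheory.measureReal_union_le _ _)
    · intro x hx
      by_cases hxV : x ∈ V₂
      · exact Or.inr ⟨hX'Y hx, hxV⟩
      · exact Or.inl ⟨hx, hxV⟩
    · exact hfin _ (Set.union_subset ((Set.sdiff_subset.trans hX'Y).trans hY1)
        (Set.inter_subset_left.trans hY1))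
  have hXpos := hXY.pos
  have hYbig := hXY.le
  have hcellX' : IsCellSet (3 * (t * B)) X' :=
    ((hXY.fine.mono (Nat.mul_le_mul_left 3 (by omega))).inter (isCellSet_cellHull _ _)).diff
      (isCellSet_cellHull _ _)
  refine ⟨X', Y', ⟨hcellX', ?_, Set.sdiff_subset, hX'Y.trans hY1, by linarith, by linarith⟩,
    Set.sdiff_subset.trans hX'Y, ?_⟩
  · rw [htBB]
    exact (hcellX'.mono (Nat.mul_le_mul_left 3 htB)).diff (isCellSet_cellHull _ _)
  · intro x hx
    constructor
    · intro q hq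
      rw [Finset.mem_Ico] at hq
      by_contra! hlt
      rcases lt_or_ge q (2 ^ (t * B)) with hqB | hqB
      · exact hx.1.2 (subset_cellHull _ _ ⟨q, Finset.mem_Ico.mpr ⟨hq.1, hqB⟩, hlt.le⟩)
      · exact hx.2 (subset_cellHull _ _ ⟨q, Finset.mem_Ico.mpr ⟨hqB, hq.2⟩, hlt.le⟩)
    · have hsub := cellHull_nearUnion_subset (α := α) (κ := 1) (Q := S) (T := t * B) (t := t)
        (fun q hq => by rw [mul_comm t B]; exact (hS.1 q hq).2.1) h3t
        (by rw [one_mul]; exact one_le_pow₀ (by norm_num))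
      obtain ⟨q, hq, hle⟩ := hsub hx.1.1.2
      exact ⟨q, hq, by linarith⟩

lemma IsCellPair.nonempty {B s : ℕ} {X Y : Set ℝ} (hXY : IsCellPair B s X Y) : Y.Nonempty := by
  rw [Set.nonempty_iff_ne_empty]
  rintro rfl
  have h₁ := hXY.pos
  have h₂ := hXY.le
  rw [MeasureTheory.measureReal_empty] at h₂
  linarith

/-- Some `β` lies in the good sets of all the scales `t₀ * (B ^ 2) ^ k`. -/
lemma BadlyApprox.exists_forall_mem_goodSet {α δ : ℝ} (h : BadlyApprox α δ) (hδ : 0 < δ) :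
    ∃ (β ε : ℝ) (B t₀ : ℕ) (S : ℕ → Finset ℕ), 0 < ε ∧ 3 ≤ B ∧ 0 < t₀ ∧ ∀ k : ℕ,
      IsGoodFamily α (1 / 24) B (t₀ * (B ^ 2) ^ k) (S k) ∧
        β ∈ goodSet α ε B (t₀ * (B ^ 2) ^ k) (S k) := by
  obtain ⟨C, hC0, hC⟩ := h.exists_sum_le hδ
  obtain ⟨B, m₀, hB, hfam⟩ := h.exists_isGoodFamily hδ
  have hB0 : (0 : ℝ) < B := by exact_mod_cast (by omega : 0 < B)
  set ε : ℝ := (1 / 8960) ^ 2 / 8 / (16 * C * B ^ 4) with hε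
  have hε0 : 0 < ε := by positivity
  have hη : 16 * ε * C * B ^ 4 ≤ (1 / 8960) ^ 2 / 8 := by
    rw [hε]
    field_simp
    rfl
  obtain ⟨n₁, hn₁⟩ := exists_nat_ge (8 / δ)
  obtain ⟨n₂, hn₂⟩ := exists_nat_ge (1 / ε)
  set s₀ := m₀ + n₁ + n₂ + 1 with hs₀
  have hbase : ∀ t : ℕ, s₀ ≤ t → m₀ ≤ t ∧ 8 ≤ δ * (t : ℝ) ∧ 1 ≤ ε * 2 ^ t := by
    intro t ht
    have h₁ : (n₁ : ℝ) ≤ t := by exact_mod_cast (by omega : n₁ ≤ t)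
    have h₂ : (n₂ : ℝ) ≤ 2 ^ t := by exact_mod_cast (by omega : n₂ ≤ t).trans Nat.lt_two_pow_self.le
    refine ⟨by omega, ?_, ?_⟩
    · rw [← div_le_iff₀' hδ]
      linarith
    · rw [← div_le_iff₀' hε0]
      linarith
  have hscale : ∀ k : ℕ, s₀ ≤ s₀ * B * (B ^ 2) ^ k := fun k => by
    rw [mul_assoc]
    exact Nat.le_mul_of_pos_right _ (by positivity)
  choose! S hS using hfam
  have hgood := fun k => hS _ (hbase _ (hscale k)).1
  set F : ℕ → Set ℝ := fun k =>
    goodSet α ε B (s₀ * B * (B ^ 2) ^ k) (S (s₀ * B * (B ^ 2) ^ k)) with hF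
  have hstep : ∀ k : ℕ, ∃ X Y, IsCellPair B (s₀ * (B ^ 2) ^ k) X Y ∧ ∀ j < k, Y ⊆ F j := by
    intro k
    induction k with
    | zero => exact ⟨_, _, isCellPair_Ico _ _, fun j hj => absurd hj (Nat.not_lt_zero j)⟩
    | succ k ih =>
      obtain ⟨X, Y, hXY, hY⟩ := ih
      have hcomm : s₀ * (B ^ 2) ^ k * B = s₀ * B * (B ^ 2) ^ k := by ring
      obtain ⟨X', Y', hXY', hY'Y, hY'⟩ := hXY.exists_next (S := S (s₀ * B * (B ^ 2) ^ k))
        h hδ hε0 hC0 hC hη hB (by positivity) (by rw [hcomm]; exact hgood k)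
        (hcomm ▸ (hbase _ (hscale k)).2.1) (hcomm ▸ (hbase _ (hscale k)).2.2)
      rw [hcomm] at hY'
      refine ⟨X', Y', by rwa [pow_succ, ← mul_assoc], fun j hj => ?_⟩
      rcases Nat.lt_succ_iff_lt_or_eq.mp hj with hj | rfl
      · exact hY'Y.trans (hY j hj)
      · exact hY'
  have hclosed : ∀ k, IsClosed (Set.Icc (0 : ℝ) 1 ∩ ⋂ j < k, F j) := fun k =>
    isClosed_Icc.inter (isClosed_biInter fun j _ => isClosed_goodSet _ _ _ _ _)
  obtain ⟨β, hβ⟩ := IsCompact.nonempty_iInter_of_sequence_nonempty_isCompact_isClosed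
    (fun k => Set.Icc (0 : ℝ) 1 ∩ ⋂ j < k, F j)
    (fun k => Set.inter_subset_inter_right _
      (Set.biInter_mono (fun j (hj : j < k) => hj.trans (Nat.lt_succ_self k)) fun _ _ => subset_rfl))
    (fun k => by
      obtain ⟨X, Y, hXY, hY⟩ := hstep k
      obtain ⟨x, hx⟩ := hXY.nonempty
      exact ⟨x, Set.Ico_subset_Icc_self (hXY.subset_Ico (hXY.subset hx)),
        Set.mem_iInter₂.mpr fun j hj => hY j hj hx⟩)
    (isCompact_Icc.inter_right (isClosed_biInter fun j _ => isClosed_goodSet _ _ _ _ _))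
    hclosed
  refine ⟨β, ε, B, s₀ * B, fun k => S (s₀ * B * (B ^ 2) ^ k), hε0, hB, by positivity,
    fun k => ⟨hgood k, ?_⟩⟩
  exact Set.mem_iInter₂.mp (Set.mem_iInter.mp hβ (k + 1)).2 k (Nat.lt_succ_self k)

theorem exists_beta_littlewood_of_badly_approximable
    (α δ : ℝ) (hδ0 : 0 < δ) (hδ1 : δ < 1)
    (hbad : ∀ q : ℕ, 0 < q → δ ≤ (q : ℝ) * nint (α * q)) :
    ∃ β : ℝ,
      0 < Filter.liminf
        (fun q : ℕ => (q : ℝ) * (Real.logb 2 q) ^ 2 * nint (α * q) * nint (β * q))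
        Filter.atTop := by
  obtain ⟨β, ε, B, t₀, S, hε, hB, ht₀, hβ⟩ :=
    BadlyApprox.exists_forall_mem_goodSet (α := α) (δ := δ) hbad hδ0
  refine ⟨β, ?_⟩
  have hB2 : 1 < B ^ 2 := Nat.one_lt_pow two_ne_zero (by omega)
  have htop : Filter.Tendsto (fun k : ℕ => t₀ * (B ^ 2) ^ k) Filter.atTop Filter.atTop :=
    (tendsto_pow_atTop_atTop_of_one_lt hB2).const_mul_atTop' ht₀
  have hlow : ∀ᶠ q : ℕ in Filter.atTop,
      ε ≤ (q : ℝ) * (Real.logb 2 q) ^ 2 * nint (α * q) * nint (β * q) := by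
    filter_upwards [Filter.eventually_ge_atTop (2 ^ t₀)] with q hq
    obtain ⟨k, hk, hk'⟩ : ∃ k, 2 ^ (t₀ * (B ^ 2) ^ k) ≤ q ∧ q < 2 ^ (t₀ * (B ^ 2) ^ (k + 1)) := by
      have hex : ∃ n, q < 2 ^ (t₀ * (B ^ 2) ^ n) := by
        obtain ⟨n, hn⟩ := (htop.eventually_ge_atTop q).exists
        exact ⟨n, hn.trans_lt Nat.lt_two_pow_self⟩
      classical
      obtain ⟨k, hk⟩ : ∃ k, Nat.find hex = k + 1 := by
        refine Nat.exists_eq_succ_of_ne_zero fun h0 => ?_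
        have := Nat.find_spec hex
        rw [h0, pow_zero, mul_one] at this
        omega
      refine ⟨k, not_lt.mp (Nat.find_min hex (by omega)), ?_⟩
      rw [← hk]
      exact Nat.find_spec hex
    have hmem := (hβ k).2.1 q (Finset.mem_Ico.mpr ⟨hk, by rwa [mul_assoc, ← pow_succ]⟩)
    set t := t₀ * (B ^ 2) ^ k
    have hq0 : (0 : ℝ) < q := by exact_mod_cast (Nat.two_pow_pos t).trans_le hk
    have hlog : (t : ℝ) ≤ Real.logb 2 q := by
      rw [Real.le_logb_iff_rpow_le one_lt_two hq0, Real.rpow_natCast]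
      exact_mod_cast hk
    refine hmem.trans ?_
    rw [weight]
    have := nint_nonneg (α * q)
    have := nint_nonneg (β * q)
    gcongr
  have hupp : ∃ᶠ q : ℕ in Filter.atTop,
      (q : ℝ) * (Real.logb 2 q) ^ 2 * nint (α * q) * nint (β * q) ≤ 2 * (B : ℝ) ^ 2 := by
    rw [Filter.frequently_atTop]
    intro N
    obtain ⟨k, hk⟩ := (htop.eventually_ge_atTop N).exists
    obtain ⟨q, hqS, hq⟩ := (hβ k).2.2
    have hqf := (hβ k).1.1 q hqS
    have hqpos := (hβ k).1.pos hqS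
    set t := t₀ * (B ^ 2) ^ k
    have hq0 : (0 : ℝ) < q := by exact_mod_cast hqpos
    have hq1 : (1 : ℝ) ≤ q := by exact_mod_cast hqpos
    refine ⟨q, ?_, ?_⟩
    · calc N ≤ 20 * t := by omega
        _ ≤ 2 ^ (20 * t) := Nat.lt_two_pow_self.le
        _ ≤ q := hqf.1
    · have hlog : Real.logb 2 q ≤ B * t := by
        rw [Real.logb_le_iff_le_rpow one_lt_two hq0]
        exact_mod_cast hqf.2.1
      have hlog0 : 0 ≤ Real.logb 2 q := Real.logb_nonneg one_lt_two hq1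
      have h₁ := nint_nonneg (α * q)
      have h₂ := nint_nonneg (β * q)
      calc _ ≤ (q : ℝ) * (B * t) ^ 2 * nint (α * q) * nint (β * q) := by gcongr
        _ = (B : ℝ) ^ 2 * (weight α t q * nint (β * q)) := by rw [weight]; ring
        _ ≤ (B : ℝ) ^ 2 * 2 := by gcongr
        _ = _ := by ring
  exact hε.trans_le (Filter.le_liminf_of_le (Filter.IsCoboundedUnder.of_frequently_le hupp) hlow)
end

section
/- Let α be a real number and 0 < δ < 1 be such that q·‖αq‖ ≥ δ for every positive integer q. Then for all positive integers μ and ν, the number of positive integers x with x < 2^{ν+1} and ‖αx‖ ≤ 2^{−μ} is at most 2^{ν−μ+4}·δ⁻¹. -/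
/-- The residues `t - round t` of two reals are at least as far apart as the distance of the
difference of these reals to the nearest integer. -/
lemma nint_sub_le (a b : ℝ) : nint (a - b) ≤ |(a - round a) - (b - round b)| := by
  have h := round_le (a - b) (round a - round b)
  push_cast at h
  have e : a - b - ((round a : ℝ) - round b) = (a - round a) - (b - round b) := by ring
  rwa [e] at h

/-- Residues of distinct multiples of a badly approximable number are well separated. -/
lemma lt_mul_abs_residue_sub {α δ : ℝ} (hδ : 0 < δ)
    (hbad : ∀ n : ℕ, 0 < n → δ ≤ (n : ℝ) * nint (α * n)) {N x y : ℕ} (hyx : y < x) (hx : x < N) :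
    δ < N * |(α * x - round (α * x)) - (α * y - round (α * y))| := by
  have h := hbad (x - y) (by omega)
  have hs := nint_sub_le (α * x) (α * y)
  rw [Nat.cast_sub hyx.le, mul_sub] at h
  have hxN : (x : ℝ) < N := by exact_mod_cast hx
  have hxy : (0 : ℝ) < x - y := sub_pos.2 (by exact_mod_cast hyx)
  have hy : (0 : ℝ) ≤ y := y.cast_nonneg
  have hpos : 0 < nint (α * x - α * y) := pos_of_mul_pos_right (hδ.trans_le h) hxy.le
  calc δ ≤ (x - y) * nint (α * x - α * y) := h
    _ < N * nint (α * x - α * y) := by gcongr; linarith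
    _ ≤ _ := by gcongr

/-- A badly approximable number has few multiples `α * x`, `0 < x < N`, within `ε` of an integer. -/
lemma card_nint_le_of_bad {α δ : ℝ} (hδ : 0 < δ)
    (hbad : ∀ n : ℕ, 0 < n → δ ≤ (n : ℝ) * nint (α * n)) (N : ℕ) {ε : ℝ} (hε : 0 ≤ ε) :
    (Nat.card {x : ℕ | 0 < x ∧ x < N ∧ nint (α * x) ≤ ε} : ℝ) ≤ 4 * (N * ε / δ) := by
  set S : Set ℕ := {x : ℕ | 0 < x ∧ x < N ∧ nint (α * x) ≤ ε}
  set T : ℝ := N * ε / δ with hT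
  have hfin : S.Finite := (Set.finite_Iio N).subset fun x hx => hx.2.1
  rcases S.eq_empty_or_nonempty with h0 | ⟨x₀, hx₀, hx₀N, hx₀ε⟩
  · rw [h0, Nat.card_coe_set_eq, Set.ncard_empty, Nat.cast_zero]
    positivity
  have hT1 : 1 ≤ T := by
    rw [hT, one_le_div hδ]
    have : (x₀ : ℝ) ≤ N := by exact_mod_cast hx₀N.le
    exact (hbad x₀ hx₀).trans (mul_le_mul this hx₀ε (abs_nonneg _) N.cast_nonneg)
  let f : ℕ → ℤ := fun x => ⌊N * (α * x - round (α * x)) / δ⌋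
  have hne : ∀ x y : ℕ, y < x → x < N → f x ≠ f y := by
    intro x y hyx hx hf
    have h1 := Int.abs_sub_lt_one_of_floor_eq_floor hf
    rw [← sub_div, ← mul_sub, abs_div, abs_mul, Nat.abs_cast, abs_of_pos hδ, div_lt_one hδ] at h1
    exact lt_asymm h1 (lt_mul_abs_residue_sub hδ hbad hyx hx)
  have hinj : Set.InjOn f hfin.toFinset := by
    intro x hx y hy hf
    rw [Set.Finite.coe_toFinset] at hx hy
    rcases lt_trichotomy x y with h | h | h
    · exact absurd hf.symm (hne y x h hy.2.1)
    · exact h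
    · exact absurd hf (hne x y h hx.2.1)
  have hmaps : Set.MapsTo f hfin.toFinset (Finset.Icc ⌊-T⌋ ⌊T⌋) := by
    intro x hx
    rw [Set.Finite.coe_toFinset] at hx
    obtain ⟨hl, hu⟩ := abs_le.1 (show |α * x - round (α * x)| ≤ ε from hx.2.2)
    rw [Finset.coe_Icc]
    refine ⟨Int.floor_le_floor ?_, Int.floor_le_floor ?_⟩
    · rw [hT, ← neg_div, ← mul_neg]
      gcongr
    · rw [hT]
      gcongr
  have hcard := Finset.card_le_card_of_injOn f hmaps hinj
  rw [Int.card_Icc] at hcard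
  have hle : ⌊-T⌋ ≤ ⌊T⌋ := Int.floor_le_floor (by linarith)
  have hcast : ((hfin.toFinset.card : ℤ) : ℝ) ≤ ((⌊T⌋ + 1 - ⌊-T⌋ : ℤ) : ℝ) := by
    exact_mod_cast (by omega : (hfin.toFinset.card : ℤ) ≤ ⌊T⌋ + 1 - ⌊-T⌋)
  rw [Nat.card_coe_set_eq, Set.ncard_eq_toFinset_card S hfin]
  push_cast at hcast
  linarith [Int.floor_le T, Int.lt_floor_add_one (-T)]

theorem card_small_fractional_part_bound
    (α δ : ℝ) (hδ0 : 0 < δ) (hδ1 : δ < 1)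
    (hbad : ∀ n : ℕ, 0 < n → δ ≤ (n : ℝ) * nint (α * n))
    (μ ν : ℕ) (hμ : 1 ≤ μ) (hν : 1 ≤ ν) :
    (Nat.card {x : ℕ | 0 < x ∧ x < 2 ^ (ν + 1) ∧ nint (α * x) ≤ (2 : ℝ) ^ (-(μ : ℝ))} : ℝ)
      ≤ (2 : ℝ) ^ ((ν : ℝ) - (μ : ℝ) + 4) * δ⁻¹ := by
  have hε : (0 : ℝ) < 2 ^ (-(μ : ℝ)) := by positivity
  refine (card_nint_le_of_bad hδ0 hbad (2 ^ (ν + 1)) hε.le).trans ?_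
  have e : (2 : ℝ) ^ ((ν : ℝ) - (μ : ℝ) + 4) = 16 * 2 ^ ν * 2 ^ (-(μ : ℝ)) := by
    rw [show (ν : ℝ) - μ + 4 = ((ν + 4 : ℕ) : ℝ) + -(μ : ℝ) by push_cast; ring,
      Real.rpow_add two_pos, Real.rpow_natCast]
    ring
  have h : (0 : ℝ) < 2 ^ ν * 2 ^ (-(μ : ℝ)) := by positivity
  rw [e, div_eq_mul_inv, ← mul_assoc]
  refine mul_le_mul_of_nonneg_right ?_ (inv_pos.2 hδ0).le
  push_cast
  rw [pow_succ]
  linarith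
end
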